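/- arXiv:1801.00378 — 6 statements merged into one kernel-verified Lean document; each statement's English description precedes it below -/
import Mathlib

section
/- Separating points: Let α₁,…,α₆ ∈ K be pairwise distinct and nonzero, and set ω_s := −val(α_s). Suppose i ≠ j are indices with ω_i = ω_j =: ω and val(α_i − α_j) = β, where β = max{ val(α_m − α_l) : m ≠ l, ω_m = ω_l = ω }. Let ζ, τ_β, τ_γ ∈ K satisfy val(ζ) = 0, val(τ_β) = β, val(α_i − α_j − ζ·τ_β) > β, and val(τ_γ) = γ for a real number γ with β < γ < val(α_i − α_j − ζ·τ_β). Define α′_s := α_s − α_j − ζ·τ_β − τ_γ for s = 1,…,6. Then every α′_s is nonzero and: (1) if ω_s > ω_i then val(α′_s) = val(α_s); (2) if ω_s < ω_i then val(α′_s) = −ω_i and val(α′_s + α_i) > −ω_i; (3) val(α′_i) = γ, and for every s ≠ i with ω_s = ω_i one has val(α′_s) = val(α_s − α_i) with −ω_i ≤ val(α′_s) ≤ β < γ. -/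
/-- **Separating points** (Lemma "sepPts").
`val : K → WithTop ℝ` is a valuation on the field `K`; `ω s = -val (α s)`.
Given indices `i ≠ j` where the maximal valuation `β` of differences among points of equal
weight `ω` is attained, the shift `α ↦ α - α j - ζ·τβ - τγ` separates the points as stated. -/
theorem separating_points
    {K : Type*} [Field K] (val : K → WithTop ℝ)
    (hval0 : ∀ x : K, val x = ⊤ ↔ x = 0)
    (hvalmul : ∀ x y : K, val (x * y) = val x + val y)
    (hvaladd : ∀ x y : K, min (val x) (val y) ≤ val (x + y))
    (α : Fin 6 → K) (hinj : Function.Injective α) (hne : ∀ s, α s ≠ 0)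
    (ω : Fin 6 → ℝ) (hω : ∀ s, val (α s) = ((-(ω s) : ℝ) : WithTop ℝ))
    (i j : Fin 6) (hij : i ≠ j) (hωij : ω i = ω j)
    (β : ℝ)
    (hβ : val (α i - α j) = (β : WithTop ℝ))
    (hβmax : ∀ m l : Fin 6, m ≠ l → ω m = ω i → ω l = ω i →
      val (α m - α l) ≤ (β : WithTop ℝ))
    (ζ τβ τγ : K)
    (hζ : val ζ = (0 : WithTop ℝ))
    (hτβ : val τβ = (β : WithTop ℝ))
    (hcanc : (β : WithTop ℝ) < val (α i - α j - ζ * τβ))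
    (γ : ℝ) (hβγ : β < γ)
    (hγ : (γ : WithTop ℝ) < val (α i - α j - ζ * τβ))
    (hτγ : val τγ = (γ : WithTop ℝ))
    (α' : Fin 6 → K) (hα' : ∀ s, α' s = α s - α j - ζ * τβ - τγ) :
    (∀ s, α' s ≠ 0) ∧
    (∀ s, ω i < ω s → val (α' s) = val (α s)) ∧
    (∀ s, ω s < ω i →
      val (α' s) = ((-(ω i) : ℝ) : WithTop ℝ) ∧
      ((-(ω i) : ℝ) : WithTop ℝ) < val (α' s + α i)) ∧
    (val (α' i) = (γ : WithTop ℝ) ∧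
      ∀ s, s ≠ i → ω s = ω i →
        val (α' s) = val (α s - α i) ∧
        ((-(ω i) : ℝ) : WithTop ℝ) ≤ val (α' s) ∧
        val (α' s) ≤ (β : WithTop ℝ)) := by
  have h1 : val 1 = 0 := by
    have h := hvalmul 1 1
    have ht : val 1 ≠ ⊤ := fun h => one_ne_zero ((hval0 1).1 h)
    rw [mul_one] at h
    lift val 1 to ℝ using ht with v
    norm_cast at h ⊢
    linarith
  have hm1 : val (-1) = 0 := by
    have h := hvalmul (-1) (-1)
    have ht : val (-1) ≠ ⊤ := fun h => (neg_ne_zero.2 one_ne_zero) ((hval0 (-1)).1 h)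
    rw [neg_mul_neg, mul_one, h1] at h
    lift val (-1) to ℝ using ht with v
    norm_cast at h ⊢
    linarith
  have hneg : ∀ x, val (-x) = val x := by
    intro x
    rw [← neg_one_mul, hvalmul, hm1, zero_add]
  have key : ∀ x y, val x < val y → val (x + y) = val x := by
    intro x y h
    have a := hvaladd x y
    rw [min_eq_left h.le] at a
    have b := hvaladd (x + y) (-y)
    rw [hneg, add_neg_cancel_right] at b
    refine le_antisymm ?_ a
    rcases min_le_iff.1 b with b | b
    · exact b
    · exact absurd b (not_le.2 h)
  have hi : val (α' i) = γ := by
    have h := key (-τγ) (α i - α j - ζ * τβ) (by rw [hneg, hτγ]; exact hγ)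
    rw [hneg, hτγ] at h
    rw [hα', ← h]
    congr 1
    ring
  have hs : ∀ s, α' s = (α s - α i) + α' i := by
    intro s
    rw [hα' s, hα' i]
    ring
  have hlow : ∀ s t, ω s = ω i → ω t = ω i →
      ((-(ω i) : ℝ) : WithTop ℝ) ≤ val (α s - α t) := by
    intro s t h h'
    have a := hvaladd (α s) (-α t)
    rw [hneg, hω, hω, h, h', min_self, ← sub_eq_add_neg] at a
    exact a
  have hωβ : -(ω i) ≤ β := by
    have h := hlow i j rfl hωij.symm
    rw [hβ] at h
    exact_mod_cast h
  have c1 : ∀ s, ω i < ω s → val (α' s) = val (α s) := by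
    intro s h
    have a : val (α s - α i) = val (α s) := by
      rw [sub_eq_add_neg]
      apply key
      rw [hneg, hω, hω]
      exact_mod_cast neg_lt_neg h
    rw [hs, key _ _ ?_, a]
    rw [a, hω, hi]
    have : -(ω s) < γ := by linarith
    exact_mod_cast this
  have c2 : ∀ s, ω s < ω i →
      val (α' s) = ((-(ω i) : ℝ) : WithTop ℝ) ∧
      ((-(ω i) : ℝ) : WithTop ℝ) < val (α' s + α i) := by
    intro s h
    have b : ((-(ω i) : ℝ) : WithTop ℝ) < val (α' s + α i) := by
      have e : α' s + α i = α s + α' i := by rw [hs]; ring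
      rw [e]
      refine lt_of_lt_of_le ?_ (hvaladd _ _)
      rw [hω, hi, lt_min_iff]
      have : -(ω i) < γ := by linarith
      exact ⟨by exact_mod_cast neg_lt_neg h, by exact_mod_cast this⟩
    refine ⟨?_, b⟩
    have a := key (-α i) (α' s + α i) (by rw [hneg, hω]; exact b)
    rw [hneg, hω] at a
    rw [← a]
    congr 1
    ring
  have c3 : ∀ s, s ≠ i → ω s = ω i →
        val (α' s) = val (α s - α i) ∧
        ((-(ω i) : ℝ) : WithTop ℝ) ≤ val (α' s) ∧
        val (α' s) ≤ (β : WithTop ℝ) := by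
    intro s hsi h
    have b := hβmax s i hsi h rfl
    have a : val (α' s) = val (α s - α i) := by
      rw [hs]
      apply key
      rw [hi]
      exact lt_of_le_of_lt b (by exact_mod_cast hβγ)
    rw [a]
    exact ⟨rfl, hlow s i h rfl, b⟩
  refine ⟨?_, c1, c2, hi, c3⟩
  intro s h0
  have ht := (hval0 _).2 h0
  rcases lt_trichotomy (ω s) (ω i) with h | h | h
  · rw [(c2 s h).1] at ht
    exact WithTop.coe_ne_top ht
  · by_cases hsi : s = i
    · rw [hsi, hi] at ht
      exact WithTop.coe_ne_top ht
    · have := (c3 s hsi h).2.2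
      rw [ht] at this
      exact absurd this (not_le.2 (WithTop.coe_lt_top β))
  · rw [c1 s h, hω] at ht
    exact WithTop.coe_ne_top ht
end

section
/- Valuations of the refined coefficients in Type (I): Let β₂, β₃, β₄, β₅, e, d ∈ K be nonzero, set α_i := β_i² for i = 2,3,4, α₅ := −β₅², and ω_i := −2·val(β_i) for i = 2,3,4,5. Assume ω₂ < ω₃ < ω₄ < ω₅, val(2) = 0, val(e) = ε with 0 < ε < (ω₃ − ω₂)/2, and val(d) = ε′ with 0 < ε′ < (ω₅ − ω₄)/2. Then val(α₂((α₃ + α₄)α₅ + α₃α₄) − α₃α₄α₅·e(2+e)) = −(ω₅ + ω₄ + ω₃ − ε) and val(α₂ + α₃ + α₄ − α₅·d(2+d)) = −(ω₅ − ε′). -/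
/-- **Valuations of the refined coefficients in Type (I).**
With `ωᵢ = −2·val βᵢ`, `ω₂ < ω₃ < ω₄ < ω₅`, `val 2 = 0`, `val e = ε` where
`0 < ε < (ω₃ − ω₂)/2`, and `val d = ε′` where `0 < ε′ < (ω₅ − ω₄)/2`, the
two exceptional coefficients of the refined modification have the stated valuations. -/
theorem typeI_refined_coefficient_valuations
    {K : Type*} [Field K] (val : K → WithTop ℝ)
    (hval0 : ∀ x : K, val x = ⊤ ↔ x = 0)
    (hvalmul : ∀ x y : K, val (x * y) = val x + val y)
    (hvaladd : ∀ x y : K, min (val x) (val y) ≤ val (x + y))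
    (β₂ β₃ β₄ β₅ e d : K)
    (hβ₂ne : β₂ ≠ 0) (hβ₃ne : β₃ ≠ 0) (hβ₄ne : β₄ ≠ 0) (hβ₅ne : β₅ ≠ 0)
    (hene : e ≠ 0) (hdne : d ≠ 0)
    (ω₂ ω₃ ω₄ ω₅ ε ε' : ℝ)
    (hβ₂ : val β₂ = ((-ω₂ / 2 : ℝ) : WithTop ℝ))
    (hβ₃ : val β₃ = ((-ω₃ / 2 : ℝ) : WithTop ℝ))
    (hβ₄ : val β₄ = ((-ω₄ / 2 : ℝ) : WithTop ℝ))
    (hβ₅ : val β₅ = ((-ω₅ / 2 : ℝ) : WithTop ℝ))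
    (h₂₃ : ω₂ < ω₃) (h₃₄ : ω₃ < ω₄) (h₄₅ : ω₄ < ω₅)
    (h2 : val (2 : K) = (0 : WithTop ℝ))
    (he : val e = (ε : WithTop ℝ)) (hε0 : 0 < ε) (hε : ε < (ω₃ - ω₂) / 2)
    (hd : val d = (ε' : WithTop ℝ)) (hε'0 : 0 < ε') (hε' : ε' < (ω₅ - ω₄) / 2) :
    let α₂ : K := β₂ ^ 2
    let α₃ : K := β₃ ^ 2
    let α₄ : K := β₄ ^ 2
    let α₅ : K := -β₅ ^ 2
    val (α₂ * ((α₃ + α₄) * α₅ + α₃ * α₄) - α₃ * α₄ * α₅ * (e * (2 + e))) =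
      ((-(ω₅ + ω₄ + ω₃ - ε) : ℝ) : WithTop ℝ) ∧
    val (α₂ + α₃ + α₄ - α₅ * (d * (2 + d))) = ((-(ω₅ - ε') : ℝ) : WithTop ℝ) := by
  have hone : val 1 = ((0 : ℝ) : WithTop ℝ) := by
    have h1 : val 1 ≠ ⊤ := fun h => one_ne_zero ((hval0 1).1 h)
    obtain ⟨r, hr⟩ := WithTop.ne_top_iff_exists.1 h1
    have h := hvalmul 1 1
    rw [mul_one, ← hr, ← WithTop.coe_add, WithTop.coe_inj] at h
    rw [← hr, WithTop.coe_inj]; linarith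
  have hm1 : val (-1) = ((0 : ℝ) : WithTop ℝ) := by
    have h1 : val (-1) ≠ ⊤ := fun h => neg_ne_zero.2 one_ne_zero ((hval0 (-1)).1 h)
    obtain ⟨r, hr⟩ := WithTop.ne_top_iff_exists.1 h1
    have h := hvalmul (-1) (-1)
    rw [neg_mul_neg, mul_one, hone, ← hr, ← WithTop.coe_add, WithTop.coe_inj] at h
    rw [← hr, WithTop.coe_inj]; linarith
  have hneg : ∀ x, val (-x) = val x := fun x => by
    rw [← neg_one_mul, hvalmul, hm1, WithTop.coe_zero, zero_add]
  have hmul : ∀ {x y : K} {a b : ℝ}, val x = (a : WithTop ℝ) → val y = (b : WithTop ℝ) →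
      val (x * y) = ((a + b : ℝ) : WithTop ℝ) := fun hx hy => by
    rw [hvalmul, hx, hy, WithTop.coe_add]
  have hadd : ∀ {x y : K} {a b : ℝ}, val x = (a : WithTop ℝ) → val y = (b : WithTop ℝ) →
      a < b → val (x + y) = (a : WithTop ℝ) := by
    intro x y a b hx hy hab
    have hab' : (a : WithTop ℝ) < (b : WithTop ℝ) := WithTop.coe_lt_coe.2 hab
    apply le_antisymm
    · by_contra! hlt
      have h := hvaladd (x + y) (-y)
      rw [add_neg_cancel_right, hneg, hx, hy] at h
      exact absurd h (not_le.2 (lt_min hlt hab'))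
    · have h := hvaladd x y
      rwa [hx, hy, min_eq_left hab'.le] at h
  have hadd' : ∀ {x y : K} {a b : ℝ}, val x = (a : WithTop ℝ) → val y = (b : WithTop ℝ) →
      b < a → val (x + y) = (b : WithTop ℝ) := fun hx hy hab => by
    rw [add_comm]; exact hadd hy hx hab
  have hsq : ∀ {x : K} {w : ℝ}, val x = ((-w / 2 : ℝ) : WithTop ℝ) →
      val (x ^ 2) = ((-w : ℝ) : WithTop ℝ) := fun {x w} hx => by
    rw [pow_two, hmul hx hx, WithTop.coe_inj]; ring
  intro α₂ α₃ α₄ α₅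
  have a2 : val α₂ = ((-ω₂ : ℝ) : WithTop ℝ) := hsq hβ₂
  have a3 : val α₃ = ((-ω₃ : ℝ) : WithTop ℝ) := hsq hβ₃
  have a4 : val α₄ = ((-ω₄ : ℝ) : WithTop ℝ) := hsq hβ₄
  have a5 : val α₅ = ((-ω₅ : ℝ) : WithTop ℝ) := (hneg _).trans (hsq hβ₅)
  have h2' : val (2 : K) = ((0 : ℝ) : WithTop ℝ) := h2
  have e2 := hmul he (hadd h2' he hε0)
  have d2 := hmul hd (hadd h2' hd hε'0)
  constructor
  · have t1 := hmul a2 (hadd (hmul (hadd' a3 a4 (by linarith)) a5) (hmul a3 a4) (by linarith))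
    have t2 := (hneg _).trans (hmul (hmul (hmul a3 a4) a5) e2)
    rw [sub_eq_add_neg, hadd' t1 t2 (by linarith), WithTop.coe_inj]; ring
  · have t1 := hadd' (hadd' a2 a3 (by linarith)) a4 (by linarith)
    have t2 := (hneg _).trans (hmul a5 d2)
    rw [sub_eq_add_neg, hadd' t1 t2 (by linarith), WithTop.coe_inj]; ring
end

section
/- Necessary residue conditions for a monomial initial form in Type (VI): Let β₃, β₄, β₅ ∈ K be nonzero with val(β₃) = val(β₄) = val(β₅), and assume val(2) = 0. Set α₅ := −β₅². If val(β₃² + β₄²) > 2·val(β₃) (the initial forms of β₃² and −β₄² agree) and val(α₅(β₃ − β₄)² + β₃²β₄²) > 4·val(β₃), then val(β₃β₄ − 2α₅) > 2·val(β₃) (the initial form of β₃β₄ equals twice the initial form of α₅). -/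
/-- **Necessary residue conditions for a monomial initial form in Type (VI).**
Suppose `β₃, β₄, β₅` are nonzero with common valuation `v` and `val 2 = 0`; set
`α₅ = −β₅²`. If the initial forms of `β₃²` and `−β₄²` agree (`val (β₃² + β₄²) > 2v`)
and `val (α₅(β₃ − β₄)² + β₃²β₄²) > 4v`, then the initial form of `β₃β₄` equals twice
that of `α₅` (`val (β₃β₄ − 2α₅) > 2v`). -/
theorem typeVI_monomial_initial_form_residue_conditions
    {K : Type*} [Field K] (val : K → WithTop ℝ)
    (hval0 : ∀ x : K, val x = ⊤ ↔ x = 0)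
    (hvalmul : ∀ x y : K, val (x * y) = val x + val y)
    (hvaladd : ∀ x y : K, min (val x) (val y) ≤ val (x + y))
    (β₃ β₄ β₅ : K) (hβ₃ne : β₃ ≠ 0) (hβ₄ne : β₄ ≠ 0) (hβ₅ne : β₅ ≠ 0)
    (v : ℝ)
    (hβ₃ : val β₃ = (v : WithTop ℝ)) (hβ₄ : val β₄ = (v : WithTop ℝ))
    (hβ₅ : val β₅ = (v : WithTop ℝ))
    (h2 : val (2 : K) = (0 : WithTop ℝ))
    (hsum : ((2 * v : ℝ) : WithTop ℝ) < val (β₃ ^ 2 + β₄ ^ 2))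
    (hx3 : ((4 * v : ℝ) : WithTop ℝ) < val ((-β₅ ^ 2) * (β₃ - β₄) ^ 2 + β₃ ^ 2 * β₄ ^ 2)) :
    ((2 * v : ℝ) : WithTop ℝ) < val (β₃ * β₄ - 2 * (-β₅ ^ 2)) := by
  have key : β₃ * β₄ * (β₃ * β₄ - 2 * (-β₅ ^ 2)) =
      ((-β₅ ^ 2) * (β₃ - β₄) ^ 2 + β₃ ^ 2 * β₄ ^ 2) + β₅ * β₅ * (β₃ ^ 2 + β₄ ^ 2) := by ring
  have e4 : ((4 * v : ℝ) : WithTop ℝ) = ((v + v : ℝ) : WithTop ℝ) + ((2 * v : ℝ) : WithTop ℝ) := by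
    rw [← WithTop.coe_add]; congr 1; ring
  have hS : ((4 * v : ℝ) : WithTop ℝ) < val (β₅ * β₅ * (β₃ ^ 2 + β₄ ^ 2)) := by
    rw [hvalmul, hvalmul, hβ₅, ← WithTop.coe_add, e4]
    exact WithTop.add_lt_add_left WithTop.coe_ne_top hsum
  have h := lt_of_lt_of_le (lt_min hx3 hS) (hvaladd _ _)
  rw [← key, hvalmul, hvalmul, hβ₃, hβ₄, ← WithTop.coe_add, e4] at h
  exact lt_of_add_lt_add_left h
end

section
/- Valuations of the Igusa numerators in Type (I): Assume α₁,…,α₆ ∈ K are pairwise distinct and nonzero with ω_i := −val(α_i) satisfying ω₁ < ω₂ < ω₃ < ω₄ < ω₅ < ω₆. Then: (a) val(D) = −(2ω₂ + 4ω₃ + 6ω₄ + 8ω₅ + 10ω₆) and val(D − α₂²α₃⁴α₄⁶α₅⁸α₆¹⁰) > val(D); (b) if val(2) = 0 then val(B) = −(2ω₃ + 2ω₄ + 4ω₅ + 4ω₆) and val(B − 4α₃²α₄²α₅⁴α₆⁴) > val(B), and val(C) = −(2ω₃ + 4ω₄ + 6ω₅ + 6ω₆) and val(C − 8α₃²α₄⁴α₅⁶α₆⁶)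 > val(C); (c) if val(6) = 0 then val(A) = −2(ω₄ + ω₅ + ω₆) and val(A − 6α₄²α₅²α₆²) > val(A). -/
namespace Genus2Igusa

variable {R : Type*} [CommRing R]

/-- `Δ_{ij} = (x − y)²`. -/
def dlt (x y : R) : R := (x - y) ^ 2

/-- Triangle product `Δ_{ij}Δ_{jk}Δ_{ki}`. -/
def tri (x y z : R) : R := dlt x y * dlt y z * dlt z x

/-- Sum over the six bijections between `{i,j,k}` and `{l,m,n}` of
`Δ_{i,σ(i)}Δ_{j,σ(j)}Δ_{k,σ(k)}`. -/
def mtch (i j k l m n : R) : R :=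
  dlt i l * dlt j m * dlt k n + dlt i l * dlt j n * dlt k m +
    dlt i m * dlt j l * dlt k n + dlt i m * dlt j n * dlt k l +
    dlt i n * dlt j l * dlt k m + dlt i n * dlt j m * dlt k l

/-- `A`: sum of `Δ_{ij}Δ_{kl}Δ_{mn}` over the 15 partitions of `{1,…,6}` into three
pairs `{i,j},{k,l},{m,n}`. -/
def igusaA (a₁ a₂ a₃ a₄ a₅ a₆ : R) : R :=
  dlt a₁ a₂ * dlt a₃ a₄ * dlt a₅ a₆ + dlt a₁ a₂ * dlt a₃ a₅ * dlt a₄ a₆ +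
    dlt a₁ a₂ * dlt a₃ a₆ * dlt a₄ a₅ +
  dlt a₁ a₃ * dlt a₂ a₄ * dlt a₅ a₆ + dlt a₁ a₃ * dlt a₂ a₅ * dlt a₄ a₆ +
    dlt a₁ a₃ * dlt a₂ a₆ * dlt a₄ a₅ +
  dlt a₁ a₄ * dlt a₂ a₃ * dlt a₅ a₆ + dlt a₁ a₄ * dlt a₂ a₅ * dlt a₃ a₆ +
    dlt a₁ a₄ * dlt a₂ a₆ * dlt a₃ a₅ +
  dlt a₁ a₅ * dlt a₂ a₃ * dlt a₄ a₆ + dlt a₁ a₅ * dlt a₂ a₄ * dlt a₃ a₆ +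
    dlt a₁ a₅ * dlt a₂ a₆ * dlt a₃ a₄ +
  dlt a₁ a₆ * dlt a₂ a₃ * dlt a₄ a₅ + dlt a₁ a₆ * dlt a₂ a₄ * dlt a₃ a₅ +
    dlt a₁ a₆ * dlt a₂ a₅ * dlt a₃ a₄

/-- `B`: sum of `(Δ_{ij}Δ_{jk}Δ_{ki})(Δ_{lm}Δ_{mn}Δ_{nl})` over the 10 partitions of
`{1,…,6}` into two 3-element sets `{i,j,k},{l,m,n}`. -/
def igusaB (a₁ a₂ a₃ a₄ a₅ a₆ : R) : R :=
  tri a₁ a₂ a₃ * tri a₄ a₅ a₆ + tri a₁ a₂ a₄ * tri a₃ a₅ a₆ +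
    tri a₁ a₂ a₅ * tri a₃ a₄ a₆ + tri a₁ a₂ a₆ * tri a₃ a₄ a₅ +
    tri a₁ a₃ a₄ * tri a₂ a₅ a₆ + tri a₁ a₃ a₅ * tri a₂ a₄ a₆ +
    tri a₁ a₃ a₆ * tri a₂ a₄ a₅ + tri a₁ a₄ a₅ * tri a₂ a₃ a₆ +
    tri a₁ a₄ a₆ * tri a₂ a₃ a₅ + tri a₁ a₅ a₆ * tri a₂ a₃ a₄

/-- `C`: sum of `(Δ_{ij}Δ_{jk}Δ_{ki})(Δ_{lm}Δ_{mn}Δ_{nl})(Δ_{il}Δ_{jm}Δ_{kn})` over the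
60 pairs consisting of a partition of `{1,…,6}` into two 3-element sets together with a
bijection between them. -/
def igusaC (a₁ a₂ a₃ a₄ a₅ a₆ : R) : R :=
  tri a₁ a₂ a₃ * tri a₄ a₅ a₆ * mtch a₁ a₂ a₃ a₄ a₅ a₆ +
    tri a₁ a₂ a₄ * tri a₃ a₅ a₆ * mtch a₁ a₂ a₄ a₃ a₅ a₆ +
    tri a₁ a₂ a₅ * tri a₃ a₄ a₆ * mtch a₁ a₂ a₅ a₃ a₄ a₆ +
    tri a₁ a₂ a₆ * tri a₃ a₄ a₅ * mtch a₁ a₂ a₆ a₃ a₄ a₅ +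
    tri a₁ a₃ a₄ * tri a₂ a₅ a₆ * mtch a₁ a₃ a₄ a₂ a₅ a₆ +
    tri a₁ a₃ a₅ * tri a₂ a₄ a₆ * mtch a₁ a₃ a₅ a₂ a₄ a₆ +
    tri a₁ a₃ a₆ * tri a₂ a₄ a₅ * mtch a₁ a₃ a₆ a₂ a₄ a₅ +
    tri a₁ a₄ a₅ * tri a₂ a₃ a₆ * mtch a₁ a₄ a₅ a₂ a₃ a₆ +
    tri a₁ a₄ a₆ * tri a₂ a₃ a₅ * mtch a₁ a₄ a₆ a₂ a₃ a₅ +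
    tri a₁ a₅ a₆ * tri a₂ a₃ a₄ * mtch a₁ a₅ a₆ a₂ a₃ a₄

/-- `D`: product of all `Δ_{ij}` for `1 ≤ i < j ≤ 6`. -/
def igusaD (a₁ a₂ a₃ a₄ a₅ a₆ : R) : R :=
  dlt a₁ a₂ * dlt a₁ a₃ * dlt a₁ a₄ * dlt a₁ a₅ * dlt a₁ a₆ *
    dlt a₂ a₃ * dlt a₂ a₄ * dlt a₂ a₅ * dlt a₂ a₆ *
    dlt a₃ a₄ * dlt a₃ a₅ * dlt a₃ a₆ *
    dlt a₄ a₅ * dlt a₄ a₆ * dlt a₅ a₆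

section aux
variable {K : Type*} [Field K]

/-- `x` has leading term `y`, of valuation `w`. -/
def Lead (val : K → WithTop ℝ) (x : K) (w : ℝ) (y : K) : Prop :=
  val y = (w : WithTop ℝ) ∧ (w : WithTop ℝ) < val (x - y)

/-- `x = y` up to valuation greater than `r`. -/
def Near (val : K → WithTop ℝ) (r : ℝ) (x y : K) : Prop := (r : WithTop ℝ) < val (x - y)

variable {val : K → WithTop ℝ}

lemma val_one' (hval0 : ∀ x : K, val x = ⊤ ↔ x = 0)
    (hvalmul : ∀ x y : K, val (x * y) = val x + val y) : val 1 = 0 := by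
  have h := hvalmul 1 1
  have h0 : val 1 ≠ ⊤ := fun h => one_ne_zero ((hval0 1).1 h)
  obtain ⟨r, hr⟩ := WithTop.ne_top_iff_exists.1 h0
  rw [mul_one, ← hr] at h
  rw [← hr]
  norm_cast at h ⊢
  linarith

lemma val_neg' (hval0 : ∀ x : K, val x = ⊤ ↔ x = 0)
    (hvalmul : ∀ x y : K, val (x * y) = val x + val y) (x : K) : val (-x) = val x := by
  have h := hvalmul (-1) (-1)
  have h0 : val (-1) ≠ ⊤ := fun h => by simpa using (hval0 (-1)).1 h
  obtain ⟨r, hr⟩ := WithTop.ne_top_iff_exists.1 h0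
  rw [neg_mul_neg, mul_one, val_one' hval0 hvalmul, ← hr] at h
  have hr0 : val (-1) = 0 := by
    rw [← hr]
    norm_cast at h ⊢
    linarith
  rw [← neg_one_mul, hvalmul, hr0, zero_add]

lemma Lead.val_eq (hval0 : ∀ x : K, val x = ⊤ ↔ x = 0)
    (hvalmul : ∀ x y : K, val (x * y) = val x + val y)
    (hvaladd : ∀ x y : K, min (val x) (val y) ≤ val (x + y))
    {x y : K} {w : ℝ} (h : Lead val x w y) : val x = (w : WithTop ℝ) := by
  obtain ⟨h1, h2⟩ := h
  apply le_antisymm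
  · by_contra! hc
    have := hvaladd x (-(x - y))
    rw [val_neg' hval0 hvalmul, show x + -(x - y) = y by ring, h1] at this
    exact absurd (lt_of_lt_of_le (lt_min hc h2) this) (lt_irrefl _)
  · have := hvaladd (x - y) y
    rw [sub_add_cancel, h1, min_eq_right h2.le] at this
    exact this

lemma Lead.mul (hval0 : ∀ x : K, val x = ⊤ ↔ x = 0)
    (hvalmul : ∀ x y : K, val (x * y) = val x + val y)
    (hvaladd : ∀ x y : K, min (val x) (val y) ≤ val (x + y))
    {x y x' y' : K} {w w' : ℝ} (h : Lead val x w y) (h' : Lead val x' w' y') :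
    Lead val (x * x') (w + w') (y * y') := by
  refine ⟨by rw [hvalmul, h.1, h'.1]; norm_cast, ?_⟩
  have e : x * x' - y * y' = x * (x' - y') + (x - y) * y' := by ring
  rw [e]
  refine lt_of_lt_of_le (lt_min ?_ ?_) (hvaladd _ _)
  · rw [hvalmul, h.val_eq hval0 hvalmul hvaladd, WithTop.coe_add]
    exact WithTop.add_lt_add_left WithTop.coe_ne_top h'.2
  · rw [hvalmul, h'.1, WithTop.coe_add]
    exact WithTop.add_lt_add_right WithTop.coe_ne_top h.2

lemma Lead.dlt (hval0 : ∀ x : K, val x = ⊤ ↔ x = 0)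
    (hvalmul : ∀ x y : K, val (x * y) = val x + val y)
    (hvaladd : ∀ x y : K, min (val x) (val y) ≤ val (x + y))
    {a b : K} {u v : ℝ} (ha : val a = ((-u : ℝ) : WithTop ℝ))
    (hb : val b = ((-v : ℝ) : WithTop ℝ)) (h : u < v) :
    Lead val (dlt a b) (-v + -v) (b * b) := by
  have h1 : Lead val (b - a) (-v) b := by
    refine ⟨hb, ?_⟩
    rw [show b - a - b = -a by ring, val_neg' hval0 hvalmul, ha]
    norm_cast
    linarith
  have e : Genus2Igusa.dlt a b = (b - a) * (b - a) := by
    unfold Genus2Igusa.dlt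
    ring
  rw [e]
  exact h1.mul hval0 hvalmul hvaladd h1

lemma dlt_comm' (a b : K) : dlt a b = dlt b a := by
  unfold dlt
  ring

lemma Near.add (hvaladd : ∀ x y : K, min (val x) (val y) ≤ val (x + y))
    {r : ℝ} {x y x' y' : K} (h : Near val r x y) (h' : Near val r x' y') :
    Near val r (x + x') (y + y') := by
  unfold Near at *
  rw [show x + x' - (y + y') = (x - y) + (x' - y') by ring]
  exact lt_of_lt_of_le (lt_min h h') (hvaladd _ _)

lemma Near.small (hval0 : ∀ x : K, val x = ⊤ ↔ x = 0)
    (hvalmul : ∀ x y : K, val (x * y) = val x + val y)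
    (hvaladd : ∀ x y : K, min (val x) (val y) ≤ val (x + y))
    {r w : ℝ} {x y : K} (h : Lead val x w y) (hr : r < w) : Near val r x 0 := by
  unfold Near
  rw [sub_zero, h.val_eq hval0 hvalmul hvaladd]
  exact_mod_cast hr

lemma Near.lead {r w : ℝ} {x y : K} (h : Lead val x w y) (hr : r ≤ w) : Near val r x y :=
  lt_of_le_of_lt (by exact_mod_cast hr) h.2

end aux

set_option linter.unusedSimpArgs false in
set_option maxHeartbeats 4000000 in
/-- **Valuations of the Igusa numerators in Type (I).**
For pairwise distinct nonzero `α₁,…,α₆` with `ωᵢ = −val αᵢ` satisfying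
`ω₁ < ω₂ < ω₃ < ω₄ < ω₅ < ω₆`, the polynomials `A`, `B`, `C`, `D` have the stated
valuations and initial terms. -/
theorem typeI_igusa_numerator_valuations
    {K : Type*} [Field K] (val : K → WithTop ℝ)
    (hval0 : ∀ x : K, val x = ⊤ ↔ x = 0)
    (hvalmul : ∀ x y : K, val (x * y) = val x + val y)
    (hvaladd : ∀ x y : K, min (val x) (val y) ≤ val (x + y))
    (a₁ a₂ a₃ a₄ a₅ a₆ : K)
    (hdist : List.Pairwise (· ≠ ·) [a₁, a₂, a₃, a₄, a₅, a₆])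
    (hne : ∀ a ∈ [a₁, a₂, a₃, a₄, a₅, a₆], a ≠ 0)
    (ω₁ ω₂ ω₃ ω₄ ω₅ ω₆ : ℝ)
    (hω₁ : val a₁ = ((-ω₁ : ℝ) : WithTop ℝ)) (hω₂ : val a₂ = ((-ω₂ : ℝ) : WithTop ℝ))
    (hω₃ : val a₃ = ((-ω₃ : ℝ) : WithTop ℝ)) (hω₄ : val a₄ = ((-ω₄ : ℝ) : WithTop ℝ))
    (hω₅ : val a₅ = ((-ω₅ : ℝ) : WithTop ℝ)) (hω₆ : val a₆ = ((-ω₆ : ℝ) : WithTop ℝ))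
    (h₁₂ : ω₁ < ω₂) (h₂₃ : ω₂ < ω₃) (h₃₄ : ω₃ < ω₄) (h₄₅ : ω₄ < ω₅) (h₅₆ : ω₅ < ω₆) :
    let A := igusaA a₁ a₂ a₃ a₄ a₅ a₆
    let B := igusaB a₁ a₂ a₃ a₄ a₅ a₆
    let C := igusaC a₁ a₂ a₃ a₄ a₅ a₆
    let D := igusaD a₁ a₂ a₃ a₄ a₅ a₆
    (val D = ((-(2 * ω₂ + 4 * ω₃ + 6 * ω₄ + 8 * ω₅ + 10 * ω₆) : ℝ) : WithTop ℝ) ∧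
      val (D - a₂ ^ 2 * a₃ ^ 4 * a₄ ^ 6 * a₅ ^ 8 * a₆ ^ 10) > val D) ∧
    (val (2 : K) = (0 : WithTop ℝ) →
      (val B = ((-(2 * ω₃ + 2 * ω₄ + 4 * ω₅ + 4 * ω₆) : ℝ) : WithTop ℝ) ∧
        val (B - 4 * (a₃ ^ 2 * a₄ ^ 2 * a₅ ^ 4 * a₆ ^ 4)) > val B ∧
        val C = ((-(2 * ω₃ + 4 * ω₄ + 6 * ω₅ + 6 * ω₆) : ℝ) : WithTop ℝ) ∧
        val (C - 8 * (a₃ ^ 2 * a₄ ^ 4 * a₅ ^ 6 * a₆ ^ 6)) > val C)) ∧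
    (val (6 : K) = (0 : WithTop ℝ) →
      (val A = ((-(2 * (ω₄ + ω₅ + ω₆)) : ℝ) : WithTop ℝ) ∧
        val (A - 6 * (a₄ ^ 2 * a₅ ^ 2 * a₆ ^ 2)) > val A)) := by
  have mulL : ∀ {x y x' y' : K} {w w' : ℝ}, Lead val x w y → Lead val x' w' y' →
      Lead val (x * x') (w + w') (y * y') := fun h h' => h.mul hval0 hvalmul hvaladd h'
  have small : ∀ {r w : ℝ} {x y : K}, Lead val x w y → r < w → Near val r x 0 :=
    fun h hr => Near.small hval0 hvalmul hvaladd h hr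
  have addN : ∀ {r : ℝ} {x y x' y' : K}, Near val r x y → Near val r x' y' →
      Near val r (x + x') (y + y') := fun h h' => h.add hvaladd h'
  have fin : ∀ {r : ℝ} {x y : K}, val y = (r : WithTop ℝ) → Near val r x y →
      val x = (r : WithTop ℝ) ∧ val (x - y) > val x := fun {r x y} h h' => by
    have hl : Lead val x r y := ⟨h, h'⟩
    have e := hl.val_eq hval0 hvalmul hvaladd
    exact ⟨e, by rw [e]; exact h'⟩
  have d₁₂ := Lead.dlt hval0 hvalmul hvaladd hω₁ hω₂ (h₁₂)
  have d₁₃ := Lead.dlt hval0 hvalmul hvaladd hω₁ hω₃ (h₁₂.trans h₂₃)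
  have d₁₄ := Lead.dlt hval0 hvalmul hvaladd hω₁ hω₄ ((h₁₂.trans h₂₃).trans h₃₄)
  have d₁₅ := Lead.dlt hval0 hvalmul hvaladd hω₁ hω₅ (((h₁₂.trans h₂₃).trans h₃₄).trans h₄₅)
  have d₁₆ := Lead.dlt hval0 hvalmul hvaladd hω₁ hω₆ ((((h₁₂.trans h₂₃).trans h₃₄).trans h₄₅).trans h₅₆)
  have d₂₃ := Lead.dlt hval0 hvalmul hvaladd hω₂ hω₃ (h₂₃)
  have d₂₄ := Lead.dlt hval0 hvalmul hvaladd hω₂ hω₄ (h₂₃.trans h₃₄)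
  have d₂₅ := Lead.dlt hval0 hvalmul hvaladd hω₂ hω₅ ((h₂₃.trans h₃₄).trans h₄₅)
  have d₂₆ := Lead.dlt hval0 hvalmul hvaladd hω₂ hω₆ (((h₂₃.trans h₃₄).trans h₄₅).trans h₅₆)
  have d₃₄ := Lead.dlt hval0 hvalmul hvaladd hω₃ hω₄ (h₃₄)
  have d₃₅ := Lead.dlt hval0 hvalmul hvaladd hω₃ hω₅ (h₃₄.trans h₄₅)
  have d₃₆ := Lead.dlt hval0 hvalmul hvaladd hω₃ hω₆ ((h₃₄.trans h₄₅).trans h₅₆)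
  have d₄₅ := Lead.dlt hval0 hvalmul hvaladd hω₄ hω₅ (h₄₅)
  have d₄₆ := Lead.dlt hval0 hvalmul hvaladd hω₄ hω₆ (h₄₅.trans h₅₆)
  have d₅₆ := Lead.dlt hval0 hvalmul hvaladd hω₅ hω₆ (h₅₆)
  intro A B C D
  refine ⟨?_, fun h2 => ?_, fun h6 => ?_⟩
  · refine fin ?_ ?_
    · simp only [hvalmul, pow_succ, pow_zero, one_mul, hω₁, hω₂, hω₃, hω₄, hω₅, hω₆]
      norm_cast
      ring
    have key : ∃ y, y = a₂ ^ 2 * a₃ ^ 4 * a₄ ^ 6 * a₅ ^ 8 * a₆ ^ 10 ∧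
        Near val (-(2 * ω₂ + 4 * ω₃ + 6 * ω₄ + 8 * ω₅ + 10 * ω₆)) D y := by
      refine ⟨_, ?_, Near.lead (by
        simp only [D, igusaD]
        repeat' first | assumption | apply mulL) ?_⟩
      · ring
      · linarith
    obtain ⟨y, rfl, h⟩ := key
    exact h
  · have h4 : val (4 : K) = 0 := by
      rw [show (4 : K) = 2 * 2 by norm_num, hvalmul, h2, add_zero]
    have h8 : val (8 : K) = 0 := by
      rw [show (8 : K) = 4 * 2 by norm_num, hvalmul, h2, h4, add_zero]
    rw [← and_assoc]
    refine ⟨fin ?_ ?_, fin ?_ ?_⟩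
    · rw [hvalmul, h4, zero_add]
      simp only [hvalmul, pow_succ, pow_zero, one_mul, hω₁, hω₂, hω₃, hω₄, hω₅, hω₆]
      norm_cast
      ring
    · have key : ∃ y, Near val (-(2 * ω₃ + 2 * ω₄ + 4 * ω₅ + 4 * ω₆)) B y ∧ y = 4 * (a₃ ^ 2 * a₄ ^ 2 * a₅ ^ 4 * a₆ ^ 4) := by
        simp only [B, igusaB, tri, mtch, mul_add]
        try simp only [dlt_comm' a₂ a₁, dlt_comm' a₃ a₁, dlt_comm' a₄ a₁, dlt_comm' a₅ a₁, dlt_comm' a₆ a₁, dlt_comm' a₃ a₂, dlt_comm' a₄ a₂, dlt_comm' a₅ a₂, dlt_comm' a₆ a₂, dlt_comm' a₄ a₃, dlt_comm' a₅ a₃, dlt_comm' a₆ a₃, dlt_comm' a₅ a₄, dlt_comm' a₆ a₄, dlt_comm' a₆ a₅]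
        apply Exists.intro
        apply And.intro
        · repeat' apply addN
          all_goals first
            | (refine small (by repeat' first | assumption | apply mulL) ?_; linarith)
            | (refine Near.lead (by repeat' first | assumption | apply mulL) ?_; linarith)
        · ring
      obtain ⟨y, h, rfl⟩ := key
      exact h
    · rw [hvalmul, h8, zero_add]
      simp only [hvalmul, pow_succ, pow_zero, one_mul, hω₁, hω₂, hω₃, hω₄, hω₅, hω₆]
      norm_cast
      ring
    · have key : ∃ y, Near val (-(2 * ω₃ + 4 * ω₄ + 6 * ω₅ + 6 * ω₆)) C y ∧ y = 8 * (a₃ ^ 2 * a₄ ^ 4 * a₅ ^ 6 * a₆ ^ 6) := by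
        simp only [C, igusaC, tri, mtch, mul_add]
        try simp only [dlt_comm' a₂ a₁, dlt_comm' a₃ a₁, dlt_comm' a₄ a₁, dlt_comm' a₅ a₁, dlt_comm' a₆ a₁, dlt_comm' a₃ a₂, dlt_comm' a₄ a₂, dlt_comm' a₅ a₂, dlt_comm' a₆ a₂, dlt_comm' a₄ a₃, dlt_comm' a₅ a₃, dlt_comm' a₆ a₃, dlt_comm' a₅ a₄, dlt_comm' a₆ a₄, dlt_comm' a₆ a₅]
        apply Exists.intro
        apply And.intro
        · repeat' apply addN
          all_goals first
            | (refine small (by repeat' first | assumption | apply mulL) ?_; linarith)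
            | (refine Near.lead (by repeat' first | assumption | apply mulL) ?_; linarith)
        · ring
      obtain ⟨y, h, rfl⟩ := key
      exact h
  · refine fin ?_ ?_
    · rw [hvalmul, h6, zero_add]
      simp only [hvalmul, pow_succ, pow_zero, one_mul, hω₁, hω₂, hω₃, hω₄, hω₅, hω₆]
      norm_cast
      ring
    · have key : ∃ y, Near val (-(2 * (ω₄ + ω₅ + ω₆))) A y ∧ y = 6 * (a₄ ^ 2 * a₅ ^ 2 * a₆ ^ 2) := by
        simp only [A, igusaA, tri, mtch, mul_add]
        try simp only [dlt_comm' a₂ a₁, dlt_comm' a₃ a₁, dlt_comm' a₄ a₁, dlt_comm' a₅ a₁, dlt_comm' a₆ a₁, dlt_comm' a₃ a₂, dlt_comm' a₄ a₂, dlt_comm' a₅ a₂, dlt_comm' a₆ a₂, dlt_comm' a₄ a₃, dlt_comm' a₅ a₃, dlt_comm' a₆ a₃, dlt_comm' a₅ a₄, dlt_comm' a₆ a₄, dlt_comm' a₆ a₅]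
        apply Exists.intro
        apply And.intro
        · repeat' apply addN
          all_goals first
            | (refine small (by repeat' first | assumption | apply mulL) ?_; linarith)
            | (refine Near.lead (by repeat' first | assumption | apply mulL) ?_; linarith)
        · ring
      obtain ⟨y, h, rfl⟩ := key
      exact h

end Genus2Igusa
end

section
/- Valuations of the Igusa numerators in Type (II): Assume α₁,…,α₆ ∈ K are pairwise distinct and nonzero with ω_i := −val(α_i) satisfying ω₁ < ω₂ < ω₃ = ω₄ < ω₅ < ω₆ and d₃₄ := −val(α₃ − α₄) < ω₃, and assume val(2) = 0. Then: val(A) = −2(ω₃ + ω₅ + ω₆) and val(A − 8α₃²α₅²α₆²) > val(A); val(B) = −4(ω₃ + ω₅ + ω₆) and val(B − 4α₃⁴α₅⁴α₆⁴) > val(B); val(C) = −6(ω₃ + ω₅ + ω₆) and val(C − 8α₃⁶α₅⁶α₆⁶) > val(C); and val(D) = −(2ω₂ + 8ω₃ + 2d₃₄ + 8ω₅ + 10ω₆) with val(D − α₂²α₃⁸(α₄ − α₃)²α₅⁸α₆¹⁰) > val(D). -/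
namespace Genus2Igusa

variable {R : Type*} [CommRing R]

def gtri (f : Fin 6 → Fin 6 → R) (i j k : Fin 6) : R := f i j * f j k * f k i

def gm (f : Fin 6 → Fin 6 → R) (i j k l m n : Fin 6) : R :=
  f i l * f j m * f k n + f i l * f j n * f k m +
    f i m * f j l * f k n + f i m * f j n * f k l +
    f i n * f j l * f k m + f i n * f j m * f k l

def gA (f : Fin 6 → Fin 6 → R) : R :=
  f 0 1 * f 2 3 * f 4 5 + f 0 1 * f 2 4 * f 3 5 + f 0 1 * f 2 5 * f 3 4 +
  f 0 2 * f 1 3 * f 4 5 + f 0 2 * f 1 4 * f 3 5 + f 0 2 * f 1 5 * f 3 4 +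
  f 0 3 * f 1 2 * f 4 5 + f 0 3 * f 1 4 * f 2 5 + f 0 3 * f 1 5 * f 2 4 +
  f 0 4 * f 1 2 * f 3 5 + f 0 4 * f 1 3 * f 2 5 + f 0 4 * f 1 5 * f 2 3 +
  f 0 5 * f 1 2 * f 3 4 + f 0 5 * f 1 3 * f 2 4 + f 0 5 * f 1 4 * f 2 3

def gBt (f : Fin 6 → Fin 6 → R) (i j k l m n : Fin 6) : R := gtri f i j k * gtri f l m n

def gCt (f : Fin 6 → Fin 6 → R) (i j k l m n : Fin 6) : R :=
  gtri f i j k * gtri f l m n * gm f i j k l m n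

def gS (t : Fin 6 → Fin 6 → Fin 6 → Fin 6 → Fin 6 → Fin 6 → R) : R :=
  t 0 1 2 3 4 5 + t 0 1 3 2 4 5 + t 0 1 4 2 3 5 + t 0 1 5 2 3 4 + t 0 2 3 1 4 5 +
  t 0 2 4 1 3 5 + t 0 2 5 1 3 4 + t 0 3 4 1 2 5 + t 0 3 5 1 2 4 + t 0 4 5 1 2 3

/-- scaling -/
theorem gA_scale (f x : Fin 6 → Fin 6 → R) (l : Fin 6 → R) (h : ∀ i j, f i j = l i * l j * x i j) :
    gA f = (l 0 * l 1 * l 2 * l 3 * l 4 * l 5) * gA x := by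
  simp only [gA, h]; ring

theorem gBt_scale (f x : Fin 6 → Fin 6 → R) (l : Fin 6 → R) (h : ∀ i j, f i j = l i * l j * x i j)
    (i j k m n p : Fin 6) :
    gBt f i j k m n p = (l i * l j * l k * l m * l n * l p) ^ 2 * gBt x i j k m n p := by
  simp only [gBt, gtri, h]; ring

theorem gCt_scale (f x : Fin 6 → Fin 6 → R) (l : Fin 6 → R) (h : ∀ i j, f i j = l i * l j * x i j)
    (i j k m n p : Fin 6) :
    gCt f i j k m n p = (l i * l j * l k * l m * l n * l p) ^ 3 * gCt x i j k m n p := by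
  simp only [gCt, gtri, gm, h]; ring

theorem gB_scale (f x : Fin 6 → Fin 6 → R) (l : Fin 6 → R) (h : ∀ i j, f i j = l i * l j * x i j) :
    gS (gBt f) = (l 0 * l 1 * l 2 * l 3 * l 4 * l 5) ^ 2 * gS (gBt x) := by
  simp only [gS, gBt_scale f x l h]; ring

theorem gC_scale (f x : Fin 6 → Fin 6 → R) (l : Fin 6 → R) (h : ∀ i j, f i j = l i * l j * x i j) :
    gS (gCt f) = (l 0 * l 1 * l 2 * l 3 * l 4 * l 5) ^ 3 * gS (gCt x) := by
  simp only [gS, gCt_scale f x l h]; ring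

section cong
variable {r : R → R → Prop} (ha : ∀ a b c d, r a b → r c d → r (a + c) (b + d))
  (hm : ∀ a b c d, r a b → r c d → r (a * c) (b * d))

theorem gA_cong (ha : ∀ a b c d, r a b → r c d → r (a + c) (b + d))
    (hm : ∀ a b c d, r a b → r c d → r (a * c) (b * d))
    (x y : Fin 6 → Fin 6 → R) (h : ∀ i j, r (x i j) (y i j)) : r (gA x) (gA y) := by
  unfold gA
  repeat' first | exact h _ _ | apply ha | apply hm

theorem gtri_cong
    (hm : ∀ a b c d, r a b → r c d → r (a * c) (b * d))
    (x y : Fin 6 → Fin 6 → R) (h : ∀ i j, r (x i j) (y i j)) (i j k) :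
    r (gtri x i j k) (gtri y i j k) := by
  unfold gtri
  repeat' first | exact h _ _ | apply hm

theorem gm_cong (ha : ∀ a b c d, r a b → r c d → r (a + c) (b + d))
    (hm : ∀ a b c d, r a b → r c d → r (a * c) (b * d))
    (x y : Fin 6 → Fin 6 → R) (h : ∀ i j, r (x i j) (y i j)) (i j k l m n) :
    r (gm x i j k l m n) (gm y i j k l m n) := by
  unfold gm
  repeat' first | exact h _ _ | apply ha | apply hm

theorem gS_cong (ha : ∀ a b c d, r a b → r c d → r (a + c) (b + d))
    (s t : Fin 6 → Fin 6 → Fin 6 → Fin 6 → Fin 6 → Fin 6 → R)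
    (h : ∀ i j k l m n, r (s i j k l m n) (t i j k l m n)) : r (gS s) (gS t) := by
  unfold gS
  repeat' first | exact h _ _ _ _ _ _ | apply ha

end cong

def yv : Fin 6 → Fin 6 → R := ![![0,0,1,1,1,1],![0,0,1,1,1,1],![1,1,0,0,1,1],![1,1,0,0,1,1],
  ![1,1,1,1,0,0],![1,1,1,1,0,0]]

theorem yA : gA (yv : Fin 6 → Fin 6 → R) = 8 := by
  simp [gA, yv]; norm_num
theorem yB : gS (gBt (yv : Fin 6 → Fin 6 → R)) = 4 := by
  simp [gS, gBt, gtri, yv]; norm_num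
theorem yC : gS (gCt (yv : Fin 6 → Fin 6 → R)) = 8 := by
  simp [gS, gCt, gtri, gm, yv]; norm_num

section V
variable {K : Type*} [Field K]

structure IsV (val : K → WithTop ℝ) : Prop where
  z : ∀ x : K, val x = ⊤ ↔ x = 0
  m : ∀ x y : K, val (x * y) = val x + val y
  a : ∀ x y : K, min (val x) (val y) ≤ val (x + y)

variable {val : K → WithTop ℝ}

theorem IsV.ex (h : IsV val) {x : K} (hx : x ≠ 0) : ∃ t : ℝ, val x = (t : WithTop ℝ) := by
  have := mt (h.z x).1 hx
  exact ⟨(val x).untop this, by simp⟩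

theorem IsV.one (h : IsV val) : val 1 = 0 := by
  obtain ⟨t, ht⟩ := h.ex (one_ne_zero (α := K))
  have := h.m 1 1
  rw [mul_one, ht] at this
  rw [ht]
  have h3 : t = t + t := by exact_mod_cast this
  have : t = 0 := by linarith
  simp [this]

theorem IsV.negone (h : IsV val) : val (-1) = 0 := by
  obtain ⟨t, ht⟩ := h.ex (neg_ne_zero.2 (one_ne_zero (α := K)))
  have := h.m (-1) (-1)
  rw [neg_mul_neg, mul_one, ht, h.one] at this
  rw [ht]
  have h3 : (0:ℝ) = t + t := by exact_mod_cast this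
  have : t = 0 := by linarith
  simp [this]

theorem IsV.neg (h : IsV val) (x : K) : val (-x) = val x := by
  rw [← neg_one_mul, h.m, h.negone, zero_add]

theorem IsV.add_pos (h : IsV val) {x y : K} (hx : 0 < val x) (hy : 0 < val y) : 0 < val (x + y) :=
  lt_of_lt_of_le (lt_min hx hy) (h.a x y)

theorem IsV.add_nn (h : IsV val) {x y : K} (hx : 0 ≤ val x) (hy : 0 ≤ val y) : 0 ≤ val (x + y) :=
  le_trans (le_min hx hy) (h.a x y)

theorem IsV.sub_pos (h : IsV val) {x y : K} (hx : 0 < val x) (hy : 0 < val y) : 0 < val (x - y) := by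
  rw [sub_eq_add_neg]; exact h.add_pos hx (by rwa [h.neg])

theorem IsV.mul_pos (h : IsV val) {x y : K} (hx : 0 < val x) (hy : 0 ≤ val y) : 0 < val (x * y) := by
  rw [h.m]; exact add_pos_of_pos_of_nonneg hx hy

def rr (val : K → WithTop ℝ) (x y : K) : Prop := 0 ≤ val x ∧ 0 ≤ val y ∧ 0 < val (x - y)

theorem IsV.radd (h : IsV val) : ∀ a b c d, rr val a b → rr val c d → rr val (a + c) (b + d) := by
  rintro a b c d ⟨h1, h2, h3⟩ ⟨h4, h5, h6⟩
  refine ⟨h.add_nn h1 h4, h.add_nn h2 h5, ?_⟩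
  rw [show a + c - (b + d) = (a - b) + (c - d) by ring]
  exact h.add_pos h3 h6

theorem IsV.rmul (h : IsV val) : ∀ a b c d, rr val a b → rr val c d → rr val (a * c) (b * d) := by
  rintro a b c d ⟨h1, h2, h3⟩ ⟨h4, h5, h6⟩
  refine ⟨by rw [h.m]; exact add_nonneg h1 h4, by rw [h.m]; exact add_nonneg h2 h5, ?_⟩
  rw [show a * c - b * d = (a - b) * c + (c - d) * b by ring]
  exact h.add_pos (h.mul_pos h3 h4) (h.mul_pos h6 h2)

theorem IsV.r0 (h : IsV val) {x z : K} (hz : 0 < val z) (hx : x = z ^ 2) : rr val x 0 := by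
  have : 0 < val x := by rw [hx, pow_two]; exact h.mul_pos hz hz.le
  exact ⟨this.le, by rw [(h.z 0).2 rfl]; exact le_top, by simpa using this⟩

theorem IsV.r1 (h : IsV val) {x z : K} (hz : 0 < val z) (hx : x = (1 - z) ^ 2) : rr val x 1 := by
  have h1 : rr val (1 - z) 1 := by
    refine ⟨?_, h.one.ge, ?_⟩
    · rw [sub_eq_add_neg]; exact h.add_nn h.one.ge (by rw [h.neg]; exact hz.le)
    · rw [show 1 - z - 1 = -z by ring, h.neg]; exact hz
  have := h.rmul _ _ _ _ h1 h1
  rw [hx, pow_two]; simpa using this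

theorem IsV.div_pos (h : IsV val) {x y : K} {s t : ℝ} (hx : val x = ((-s : ℝ) : WithTop ℝ))
    (hy : val y = ((-t : ℝ) : WithTop ℝ)) (hst : s < t) : 0 < val (x / y) := by
  have hy0 : y ≠ 0 := by
    intro h0; rw [(h.z y).2 h0] at hy; exact WithTop.top_ne_coe hy
  by_cases hx0 : x = 0
  · rw [hx0, zero_div, (h.z 0).2 rfl]; exact WithTop.coe_lt_top 0
  obtain ⟨q, hq⟩ := h.ex (div_ne_zero hx0 hy0)
  have := h.m (x / y) y
  rw [div_mul_cancel₀ _ hy0, hx, hy, hq] at this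
  have h3 : -s = q + -t := by exact_mod_cast this
  rw [hq]
  have : 0 < q := by linarith
  exact_mod_cast this

theorem IsV.pow (h : IsV val) {x : K} {s : ℝ} (hx : val x = ((-s : ℝ) : WithTop ℝ)) (n : ℕ) :
    val (x ^ n) = ((-(n * s) : ℝ) : WithTop ℝ) := by
  induction n with
  | zero => simp [h.one]
  | succ n ih =>
    rw [pow_succ, h.m, ih, hx, ← WithTop.coe_add]; congr 1; push_cast; ring

theorem IsV.mul' (h : IsV val) {x y : K} {s t : ℝ} (hx : val x = ((-s : ℝ) : WithTop ℝ))
    (hy : val y = ((-t : ℝ) : WithTop ℝ)) : val (x * y) = ((-(s + t) : ℝ) : WithTop ℝ) := by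
  rw [h.m, hx, hy, ← WithTop.coe_add]; congr 1; ring

theorem IsV.final (h : IsV val) {X L c n : K} {w : ℝ} (hL : val L = (w : WithTop ℝ))
    (hX : X = L * c) (hc : rr val c n) (hn : val n = 0) :
    val X = (w : WithTop ℝ) ∧ val (X - n * L) > val X := by
  have hc0 : val c = 0 := by
    refine le_antisymm ?_ hc.1
    by_contra hlt
    push Not at hlt
    have := h.sub_pos hlt hc.2.2
    rw [show c - (c - n) = n by ring, hn] at this
    exact lt_irrefl _ this
  have h1 : val X = (w : WithTop ℝ) := by rw [hX, h.m, hL, hc0, add_zero]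
  refine ⟨h1, ?_⟩
  rw [h1, hX, show L * c - n * L = L * (c - n) by ring, h.m, hL]
  by_cases h0 : c - n = 0
  · rw [h0, (h.z 0).2 rfl]; simp
  obtain ⟨q, hq⟩ := h.ex h0
  have := hc.2.2
  rw [hq] at this ⊢
  have h3 : 0 < q := by exact_mod_cast this
  have : w < w + q := by linarith
  exact_mod_cast this

end V

set_option maxHeartbeats 2000000 in
/-- **Valuations of the Igusa numerators in Type (II).**
For pairwise distinct nonzero `α₁,…,α₆` with `ωᵢ = −val αᵢ` satisfying
`ω₁ < ω₂ < ω₃ = ω₄ < ω₅ < ω₆`, `d₃₄ = −val (α₃ − α₄) < ω₃` and `val 2 = 0`, the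
polynomials `A`, `B`, `C`, `D` have the stated valuations and initial terms. -/
theorem typeII_igusa_numerator_valuations
    {K : Type*} [Field K] (val : K → WithTop ℝ)
    (hval0 : ∀ x : K, val x = ⊤ ↔ x = 0)
    (hvalmul : ∀ x y : K, val (x * y) = val x + val y)
    (hvaladd : ∀ x y : K, min (val x) (val y) ≤ val (x + y))
    (a₁ a₂ a₃ a₄ a₅ a₆ : K)
    (hdist : List.Pairwise (· ≠ ·) [a₁, a₂, a₃, a₄, a₅, a₆])
    (hne : ∀ a ∈ [a₁, a₂, a₃, a₄, a₅, a₆], a ≠ 0)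
    (ω₁ ω₂ ω₃ ω₄ ω₅ ω₆ d₃₄ : ℝ)
    (hω₁ : val a₁ = ((-ω₁ : ℝ) : WithTop ℝ)) (hω₂ : val a₂ = ((-ω₂ : ℝ) : WithTop ℝ))
    (hω₃ : val a₃ = ((-ω₃ : ℝ) : WithTop ℝ)) (hω₄ : val a₄ = ((-ω₄ : ℝ) : WithTop ℝ))
    (hω₅ : val a₅ = ((-ω₅ : ℝ) : WithTop ℝ)) (hω₆ : val a₆ = ((-ω₆ : ℝ) : WithTop ℝ))
    (h₁₂ : ω₁ < ω₂) (h₂₃ : ω₂ < ω₃) (h₃₄ : ω₃ = ω₄) (h₄₅ : ω₄ < ω₅) (h₅₆ : ω₅ < ω₆)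
    (hd₃₄ : val (a₃ - a₄) = ((-d₃₄ : ℝ) : WithTop ℝ)) (hd : d₃₄ < ω₃)
    (h2 : val (2 : K) = (0 : WithTop ℝ)) :
    let A := igusaA a₁ a₂ a₃ a₄ a₅ a₆
    let B := igusaB a₁ a₂ a₃ a₄ a₅ a₆
    let C := igusaC a₁ a₂ a₃ a₄ a₅ a₆
    let D := igusaD a₁ a₂ a₃ a₄ a₅ a₆
    (val A = ((-(2 * (ω₃ + ω₅ + ω₆)) : ℝ) : WithTop ℝ) ∧
      val (A - 8 * (a₃ ^ 2 * a₅ ^ 2 * a₆ ^ 2)) > val A) ∧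
    (val B = ((-(4 * (ω₃ + ω₅ + ω₆)) : ℝ) : WithTop ℝ) ∧
      val (B - 4 * (a₃ ^ 4 * a₅ ^ 4 * a₆ ^ 4)) > val B) ∧
    (val C = ((-(6 * (ω₃ + ω₅ + ω₆)) : ℝ) : WithTop ℝ) ∧
      val (C - 8 * (a₃ ^ 6 * a₅ ^ 6 * a₆ ^ 6)) > val C) ∧
    (val D = ((-(2 * ω₂ + 8 * ω₃ + 2 * d₃₄ + 8 * ω₅ + 10 * ω₆) : ℝ) : WithTop ℝ) ∧
      val (D - a₂ ^ 2 * a₃ ^ 8 * (a₄ - a₃) ^ 2 * a₅ ^ 8 * a₆ ^ 10) > val D) := by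
  have h : IsV val := ⟨hval0, hvalmul, hvaladd⟩
  have n2 : a₂ ≠ 0 := hne _ (by simp)
  have n3 : a₃ ≠ 0 := hne _ (by simp)
  have n5 : a₅ ≠ 0 := hne _ (by simp)
  have n6 : a₆ ≠ 0 := hne _ (by simp)
  have n43 : a₄ - a₃ ≠ 0 := by
    intro h0
    rw [show a₃ - a₄ = 0 by linear_combination -h0, (hval0 0).2 rfl] at hd₃₄
    exact WithTop.top_ne_coe hd₃₄
  have hd43 : val (a₄ - a₃) = ((-d₃₄ : ℝ) : WithTop ℝ) := by
    rw [← neg_sub, h.neg, hd₃₄]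
  have p12 := h.div_pos hω₁ hω₂ h₁₂
  have p13 := h.div_pos hω₁ hω₃ (by linarith)
  have p23 := h.div_pos hω₂ hω₃ (by linarith)
  have p43 := h.div_pos hd43 hω₃ hd
  have p15 := h.div_pos hω₁ hω₅ (by linarith)
  have p25 := h.div_pos hω₂ hω₅ (by linarith)
  have p35 := h.div_pos hω₃ hω₅ (by linarith)
  have p45 := h.div_pos hω₄ hω₅ (by linarith)
  have p16 := h.div_pos hω₁ hω₆ (by linarith)
  have p26 := h.div_pos hω₂ hω₆ (by linarith)
  have p36 := h.div_pos hω₃ hω₆ (by linarith)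
  have p46 := h.div_pos hω₄ hω₆ (by linarith)
  have p56 := h.div_pos hω₅ hω₆ (by linarith)
  let a : Fin 6 → K := ![a₁, a₂, a₃, a₄, a₅, a₆]
  let l : Fin 6 → K := ![a₃, a₃, a₃, a₃, a₅ ^ 2 / a₃, a₆ ^ 2 / a₃]
  let f : Fin 6 → Fin 6 → K := fun i j => dlt (a i) (a j)
  let x : Fin 6 → Fin 6 → K := fun i j => f i j / (l i * l j)
  have hl : ∀ i, l i ≠ 0 := by
    intro i; fin_cases i <;> simp [l, n3, n5, n6]
  have hf : ∀ i j, f i j = l i * l j * x i j := by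
    intro i j
    have := hl i
    have := hl j
    simp only [x]; field_simp
  have hsymm : ∀ i j, x i j = x j i := by
    intro i j; simp only [x, f, dlt]; rw [mul_comm (l j)]; congr 1; ring
  have hdiag : ∀ i, rr val (x i i) 0 := by
    intro i
    refine h.r0 (z := 0) (by rw [(hval0 0).2 rfl]; exact WithTop.coe_lt_top 0) (by simp [x, f, dlt])
  have x01 : rr val (x 0 1) 0 := h.r0 (h.sub_pos p13 p23) (by simp [x, f, dlt, a, l]; field_simp)
  have x02 : rr val (x 0 2) 1 := h.r1 p13 (by simp [x, f, dlt, a, l]; field_simp; ring)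
  have x03 : rr val (x 0 3) 1 := h.r1 (h.sub_pos p13 p43) (by simp [x, f, dlt, a, l]; field_simp; ring)
  have x04 : rr val (x 0 4) 1 := h.r1 p15 (by simp [x, f, dlt, a, l]; field_simp; ring)
  have x05 : rr val (x 0 5) 1 := h.r1 p16 (by simp [x, f, dlt, a, l]; field_simp; ring)
  have x12 : rr val (x 1 2) 1 := h.r1 p23 (by simp [x, f, dlt, a, l]; field_simp; ring)
  have x13 : rr val (x 1 3) 1 := h.r1 (h.sub_pos p23 p43) (by simp [x, f, dlt, a, l]; field_simp; ring)
  have x14 : rr val (x 1 4) 1 := h.r1 p25 (by simp [x, f, dlt, a, l]; field_simp; ring)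
  have x15 : rr val (x 1 5) 1 := h.r1 p26 (by simp [x, f, dlt, a, l]; field_simp; ring)
  have x23 : rr val (x 2 3) 0 := h.r0 p43 (by simp [x, f, dlt, a, l]; field_simp; ring)
  have x24 : rr val (x 2 4) 1 := h.r1 p35 (by simp [x, f, dlt, a, l]; field_simp; ring)
  have x25 : rr val (x 2 5) 1 := h.r1 p36 (by simp [x, f, dlt, a, l]; field_simp; ring)
  have x34 : rr val (x 3 4) 1 := h.r1 p45 (by simp [x, f, dlt, a, l]; field_simp; ring)
  have x35 : rr val (x 3 5) 1 := h.r1 p46 (by simp [x, f, dlt, a, l]; field_simp; ring)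
  have x45 : rr val (x 4 5) 0 := h.r0 (h.sub_pos p36 p35) (by simp [x, f, dlt, a, l]; field_simp)
  have hxy : ∀ i j, rr val (x i j) (yv i j) := by
    intro i j
    fin_cases i <;> fin_cases j <;> first | exact hdiag _ | assumption | (rw [hsymm]; assumption)
  have v4 : val (4 : K) = 0 := by
    rw [show (4 : K) = 2 * 2 by norm_num, hvalmul, h2, add_zero]
  have v8 : val (8 : K) = 0 := by
    rw [show (8 : K) = 4 * 2 by norm_num, hvalmul, h2, v4, add_zero]
  have hll : l 0 * l 1 * l 2 * l 3 * l 4 * l 5 = a₃ ^ 2 * a₅ ^ 2 * a₆ ^ 2 := by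
    simp [l]; field_simp
  have vL : ∀ n : ℕ, val (a₃ ^ n * a₅ ^ n * a₆ ^ n) = ((-(n * (ω₃ + ω₅ + ω₆)) : ℝ) : WithTop ℝ) := by
    intro n
    rw [h.mul' (h.mul' (h.pow hω₃ n) (h.pow hω₅ n)) (h.pow hω₆ n)]; congr 1; ring
  intro A B C D
  refine ⟨?_, ?_, ?_, ?_⟩
  · refine h.final (c := gA x) (by simpa using vL 2) ?_ ?_ v8
    · rw [← hll, ← gA_scale f x l hf]; rfl
    · rw [← yA]; exact gA_cong h.radd h.rmul x yv hxy
  · refine h.final (c := gS (gBt x)) (by simpa using vL 4) ?_ ?_ v4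
    · rw [show a₃ ^ 4 * a₅ ^ 4 * a₆ ^ 4 = (a₃ ^ 2 * a₅ ^ 2 * a₆ ^ 2) ^ 2 by ring,
        ← hll, ← gB_scale f x l hf]; rfl
    · rw [← yB]
      refine gS_cong h.radd _ _ fun i j k l m n => ?_
      exact h.rmul _ _ _ _ (gtri_cong h.rmul x yv hxy _ _ _) (gtri_cong h.rmul x yv hxy _ _ _)
  · refine h.final (c := gS (gCt x)) (by simpa using vL 6) ?_ ?_ v8
    · rw [show a₃ ^ 6 * a₅ ^ 6 * a₆ ^ 6 = (a₃ ^ 2 * a₅ ^ 2 * a₆ ^ 2) ^ 3 by ring,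
        ← hll, ← gC_scale f x l hf]; rfl
    · rw [← yC]
      refine gS_cong h.radd _ _ fun i j k l m n => ?_
      exact h.rmul _ _ _ _ (h.rmul _ _ _ _ (gtri_cong h.rmul x yv hxy _ _ _)
        (gtri_cong h.rmul x yv hxy _ _ _)) (gm_cong h.radd h.rmul x yv hxy _ _ _ _ _ _)
  · have w01 : rr val (((a₁ - a₂) / a₂) ^ 2) 1 := h.r1 p12 (by field_simp; ring)
    have key := h.final (X := D) (L := a₂ ^ 2 * a₃ ^ 8 * (a₄ - a₃) ^ 2 * a₅ ^ 8 * a₆ ^ 10)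
      (c := ((a₁ - a₂) / a₂) ^ 2 * x 0 2 * x 0 3 * x 0 4 * x 0 5 * x 1 2 * x 1 3 * x 1 4 * x 1 5 *
        x 2 4 * x 2 5 * x 3 4 * x 3 5 * ((a₅ - a₆) / a₆) ^ 2) (n := 1)
      (w := -(2 * ω₂ + 8 * ω₃ + 2 * d₃₄ + 8 * ω₅ + 10 * ω₆)) ?_ ?_ ?_ h.one
    · rwa [one_mul] at key
    · rw [h.mul' (h.mul' (h.mul' (h.mul' (h.pow hω₂ 2) (h.pow hω₃ 8)) (h.pow hd43 2))
        (h.pow hω₅ 8)) (h.pow hω₆ 10)]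
      congr 1
    · have q3 : a₃ * a₃ = a₃ ^ 2 := by ring
      have q5 : a₃ * (a₅ ^ 2 / a₃) = a₅ ^ 2 := by field_simp
      have q6 : a₃ * (a₆ ^ 2 / a₃) = a₆ ^ 2 := by field_simp
      have e02 : dlt a₁ a₃ = a₃ ^ 2 * x 0 2 := by
        rw [← q3]; exact hf 0 2
      have e03 : dlt a₁ a₄ = a₃ ^ 2 * x 0 3 := by
        rw [← q3]; exact hf 0 3
      have e04 : dlt a₁ a₅ = a₅ ^ 2 * x 0 4 := by
        rw [← q5]; exact hf 0 4
      have e05 : dlt a₁ a₆ = a₆ ^ 2 * x 0 5 := by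
        rw [← q6]; exact hf 0 5
      have e12 : dlt a₂ a₃ = a₃ ^ 2 * x 1 2 := by
        rw [← q3]; exact hf 1 2
      have e13 : dlt a₂ a₄ = a₃ ^ 2 * x 1 3 := by
        rw [← q3]; exact hf 1 3
      have e14 : dlt a₂ a₅ = a₅ ^ 2 * x 1 4 := by
        rw [← q5]; exact hf 1 4
      have e15 : dlt a₂ a₆ = a₆ ^ 2 * x 1 5 := by
        rw [← q6]; exact hf 1 5
      have e24 : dlt a₃ a₅ = a₅ ^ 2 * x 2 4 := by
        rw [← q5]; exact hf 2 4
      have e25 : dlt a₃ a₆ = a₆ ^ 2 * x 2 5 := by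
        rw [← q6]; exact hf 2 5
      have e34 : dlt a₄ a₅ = a₅ ^ 2 * x 3 4 := by
        rw [← q5]; exact hf 3 4
      have e35 : dlt a₄ a₆ = a₆ ^ 2 * x 3 5 := by
        rw [← q6]; exact hf 3 5
      have e01 : dlt a₁ a₂ = a₂ ^ 2 * ((a₁ - a₂) / a₂) ^ 2 := by unfold dlt; field_simp
      have e45 : dlt a₅ a₆ = a₆ ^ 2 * ((a₅ - a₆) / a₆) ^ 2 := by unfold dlt; field_simp
      have e23 : dlt a₃ a₄ = (a₄ - a₃) ^ 2 := by unfold dlt; ring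
      generalize ((a₁ - a₂) / a₂) ^ 2 = y at *
      generalize ((a₅ - a₆) / a₆) ^ 2 = y' at *
      clear_value x
      simp only [D, igusaD, e01, e45, e23, e02, e03, e04, e05, e12, e13, e14, e15, e24, e25, e34, e35]
      clear_value a l
      generalize (a₄ - a₃) ^ 2 = y''
      ring
    · have w45 : rr val (((a₅ - a₆) / a₆) ^ 2) 1 := h.r1 p56 (by field_simp; ring)
      have := h.rmul
      have e : (1 : K) = 1 * 1 * 1 * 1 * 1 * 1 * 1 * 1 * 1 * 1 * 1 * 1 * 1 * 1 := by norm_num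
      rw [e]
      repeat' first | assumption | apply h.rmul

end Genus2Igusa
end

section
/- The invariant j₃′ = j₂ − 3j₃ on the dumbbell cone: Assume α₁,…,α₆ ∈ K are pairwise distinct and nonzero with ω_i := −val(α_i) satisfying ω₁ < ω₂ < ω₃ < ω₄ < ω₅ < ω₆, and assume val(6) = 0. Then val(A·B − 3C) = −(3ω₃ + 3ω₄ + 6ω₅ + 6ω₆) and val(A·B − 3C − 8α₃³α₄³α₅⁶α₆⁶) > val(A·B − 3C); consequently, with L₀ = (ω₄ − ω₃)/2, L₁ = 2(ω₅ − ω₄), L₂ = 2(ω₃ − ω₂), one has −val(A²(A·B − 3C)/D) = L₁ + 6L₀ + L₂. -/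
namespace Genus2Igusa

variable {R : Type*} [CommRing R]

section helpers

theorem dlt_comm {S : Type*} [CommRing S] (x y : S) : dlt x y = dlt y x := by
  unfold dlt; ring

def eA {S : Type*} [CommRing S] (e12 e13 e14 e15 e16 e23 e24 e25 e26 e34 e35 e36 e45 e46 e56 : S) : S :=
  e12 * e34 * e56 + e12 * e35 * e46 + e12 * e36 * e45 + e13 * e24 * e56 + e13 * e25 * e46 + 
      e13 * e26 * e45 + e14 * e23 * e56 + e14 * e25 * e36 + e14 * e26 * e35 + e15 * e23 * e46 + 
      e15 * e24 * e36 + e15 * e26 * e34 + e16 * e23 * e45 + e16 * e24 * e35 + e16 * e25 * e34 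

def eB {S : Type*} [CommRing S] (e12 e13 e14 e15 e16 e23 e24 e25 e26 e34 e35 e36 e45 e46 e56 : S) : S :=
  e12 * e13 * e23 * e45 * e46 * e56 +
    e12 * e14 * e24 * e35 * e36 * e56 +
    e12 * e15 * e25 * e34 * e36 * e46 +
    e12 * e16 * e26 * e34 * e35 * e45 +
    e13 * e14 * e34 * e25 * e26 * e56 +
    e13 * e15 * e35 * e24 * e26 * e46 +
    e13 * e16 * e36 * e24 * e25 * e45 +
    e14 * e15 * e45 * e23 * e26 * e36 +
    e14 * e16 * e46 * e23 * e25 * e35 +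
    e15 * e16 * e56 * e23 * e24 * e34

def eC {S : Type*} [CommRing S] (e12 e13 e14 e15 e16 e23 e24 e25 e26 e34 e35 e36 e45 e46 e56 : S) : S :=
  e12 * e13 * e23 * e45 * e46 * e56 * (e14 * e25 * e36 + e14 * e26 * e35 + e15 * e24 * e36 + e15 * e26 * e34 + e16 * e24 * e35 + e16 * e25 * e34) +
    e12 * e14 * e24 * e35 * e36 * e56 * (e13 * e25 * e46 + e13 * e26 * e45 + e15 * e23 * e46 + e15 * e26 * e34 + e16 * e23 * e45 + e16 * e25 * e34) +
    e12 * e15 * e25 * e34 * e36 * e46 * (e13 * e24 * e56 + e13 * e26 * e45 + e14 * e23 * e56 + e14 * e26 * e35 + e16 * e23 * e45 + e16 * e24 * e35) +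
    e12 * e16 * e26 * e34 * e35 * e45 * (e13 * e24 * e56 + e13 * e25 * e46 + e14 * e23 * e56 + e14 * e25 * e36 + e15 * e23 * e46 + e15 * e24 * e36) +
    e13 * e14 * e34 * e25 * e26 * e56 * (e12 * e35 * e46 + e12 * e36 * e45 + e15 * e23 * e46 + e15 * e36 * e24 + e16 * e23 * e45 + e16 * e35 * e24) +
    e13 * e15 * e35 * e24 * e26 * e46 * (e12 * e34 * e56 + e12 * e36 * e45 + e14 * e23 * e56 + e14 * e36 * e25 + e16 * e23 * e45 + e16 * e34 * e25) +
    e13 * e16 * e36 * e24 * e25 * e45 * (e12 * e34 * e56 + e12 * e35 * e46 + e14 * e23 * e56 + e14 * e35 * e26 + e15 * e23 * e46 + e15 * e34 * e26) +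
    e14 * e15 * e45 * e23 * e26 * e36 * (e12 * e34 * e56 + e12 * e46 * e35 + e13 * e24 * e56 + e13 * e46 * e25 + e16 * e24 * e35 + e16 * e34 * e25) +
    e14 * e16 * e46 * e23 * e25 * e35 * (e12 * e34 * e56 + e12 * e45 * e36 + e13 * e24 * e56 + e13 * e45 * e26 + e15 * e24 * e36 + e15 * e34 * e26) +
    e15 * e16 * e56 * e23 * e24 * e34 * (e12 * e35 * e46 + e12 * e45 * e36 + e13 * e25 * e46 + e13 * e45 * e26 + e14 * e25 * e36 + e14 * e35 * e26)

set_option linter.unusedSimpArgs false in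
theorem scale {S : Type*} [CommRing S] (a₁ a₂ a₃ a₄ a₅ a₆ c1 c2 c3 c4 c5 c6
    e12 e13 e14 e15 e16 e23 e24 e25 e26 e34 e35 e36 e45 e46 e56 : S)
    (h12 : dlt a₁ a₂ = e12 * (c1 * c2))
    (h13 : dlt a₁ a₃ = e13 * (c1 * c3))
    (h14 : dlt a₁ a₄ = e14 * (c1 * c4))
    (h15 : dlt a₁ a₅ = e15 * (c1 * c5))
    (h16 : dlt a₁ a₆ = e16 * (c1 * c6))
    (h23 : dlt a₂ a₃ = e23 * (c2 * c3))
    (h24 : dlt a₂ a₄ = e24 * (c2 * c4))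
    (h25 : dlt a₂ a₅ = e25 * (c2 * c5))
    (h26 : dlt a₂ a₆ = e26 * (c2 * c6))
    (h34 : dlt a₃ a₄ = e34 * (c3 * c4))
    (h35 : dlt a₃ a₅ = e35 * (c3 * c5))
    (h36 : dlt a₃ a₆ = e36 * (c3 * c6))
    (h45 : dlt a₄ a₅ = e45 * (c4 * c5))
    (h46 : dlt a₄ a₆ = e46 * (c4 * c6))
    (h56 : dlt a₅ a₆ = e56 * (c5 * c6)) :
    igusaA a₁ a₂ a₃ a₄ a₅ a₆ = (c1 * c2 * c3 * c4 * c5 * c6) * eA e12 e13 e14 e15 e16 e23 e24 e25 e26 e34 e35 e36 e45 e46 e56 ∧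
    igusaB a₁ a₂ a₃ a₄ a₅ a₆ = (c1 * c2 * c3 * c4 * c5 * c6) ^ 2 * eB e12 e13 e14 e15 e16 e23 e24 e25 e26 e34 e35 e36 e45 e46 e56 ∧
    igusaC a₁ a₂ a₃ a₄ a₅ a₆ = (c1 * c2 * c3 * c4 * c5 * c6) ^ 3 * eC e12 e13 e14 e15 e16 e23 e24 e25 e26 e34 e35 e36 e45 e46 e56 := by
  refine ⟨?_, ?_, ?_⟩
  · simp only [igusaA, eA, h12, h13, h14, h15, h16, h23, h24, h25, h26, h34, h35, h36, h45, h46, h56]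
    ring
  · simp only [igusaB, tri, eB, dlt_comm a₂ a₁, dlt_comm a₃ a₁, dlt_comm a₄ a₁, dlt_comm a₅ a₁, dlt_comm a₆ a₁, dlt_comm a₃ a₂, dlt_comm a₄ a₂, dlt_comm a₅ a₂, dlt_comm a₆ a₂, dlt_comm a₄ a₃, dlt_comm a₅ a₃, dlt_comm a₆ a₃, dlt_comm a₅ a₄, dlt_comm a₆ a₄, dlt_comm a₆ a₅, h12, h13, h14, h15, h16, h23, h24, h25, h26, h34, h35, h36, h45, h46, h56]
    ring
  · simp only [igusaC, tri, mtch, eC, dlt_comm a₂ a₁, dlt_comm a₃ a₁, dlt_comm a₄ a₁, dlt_comm a₅ a₁, dlt_comm a₆ a₁, dlt_comm a₃ a₂, dlt_comm a₄ a₂, dlt_comm a₅ a₂, dlt_comm a₆ a₂, dlt_comm a₄ a₃, dlt_comm a₅ a₃, dlt_comm a₆ a₃, dlt_comm a₅ a₄, dlt_comm a₆ a₄, dlt_comm a₆ a₅, h12, h13, h14, h15, h16, h23, h24, h25, h26, h34, h35, h36, h45, h46, h56]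
    ring

theorem eA_lead {S : Type*} [CommRing S] (p q r : S) : ∃ P Q R : S,
    eA ((0-(p*q*r))^2) ((0-(q*r))^2) ((0-r)^2) ((0-1)^2) 1 (((p*q*r)-(q*r))^2) (((p*q*r)-r)^2) 
      (((p*q*r)-1)^2) 1 (((q*r)-r)^2) (((q*r)-1)^2) 1 ((r-1)^2) 1 1  = r ^ 2 * (6 + (p * P + q * Q + r * R)) := by
  refine ⟨- 4*q - 4*q*r - 4*q^2 + 12*q^2*r - 4*q^2*r^2 - 4*q^3*r - 4*q^3*r^2 + 6*p*q^2 - 4*p*q^2*r + 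
      6*p*q^2*r^2 - 4*p*q^3*r - 4*p*q^3*r^2 + 6*p*q^4*r^2 , - 4 - 4*r + 6*q - 4*q*r + 6*q*r^2 , 0 , ?_⟩
  unfold eA
  ring

def eP0 {S : Type*} [CommRing S] (q r : S) : S :=
  - 12 + 18*r + 18*r^2 - 12*r^3 - 12*q + 24*q*r - 36*q*r^2 + 24*q*r^3 - 12*q*r^4 + 18*q^2*r 
      - 36*q^2*r^2 - 36*q^2*r^3 + 18*q^2*r^4 + 18*q^3*r^2 + 24*q^3*r^3 + 18*q^3*r^4 - 12*q^4*r^3 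
      - 12*q^4*r^4 

def eP1 {S : Type*} [CommRing S] (q r : S) : S :=
  - 12 + 18*r + 18*r^2 - 12*r^3 + 48*q - 36*q*r - 96*q*r^2 - 36*q*r^3 + 48*q*r^4 - 12*q^2 - 
      36*q^2*r + 108*q^2*r^2 + 108*q^2*r^3 - 36*q^2*r^4 - 12*q^2*r^5 + 18*q^3*r - 96*q^3*r^2 + 
      108*q^3*r^3 - 96*q^3*r^4 + 18*q^3*r^5 + 18*q^4*r^2 - 36*q^4*r^3 - 36*q^4*r^4 + 18*q^4*r^5 
      - 12*q^5*r^3 + 48*q^5*r^4 - 12*q^5*r^5 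

def eP2 {S : Type*} [CommRing S] (q r : S) : S :=
  8 - 12*r - 12*r^2 + 8*r^3 - 12*q + 24*q*r - 36*q*r^2 + 24*q*r^3 - 12*q*r^4 - 12*q^2 - 
      36*q^2*r + 108*q^2*r^2 + 108*q^2*r^3 - 36*q^2*r^4 - 12*q^2*r^5 + 8*q^3 + 24*q^3*r + 
      108*q^3*r^2 - 480*q^3*r^3 + 108*q^3*r^4 + 24*q^3*r^5 + 8*q^3*r^6 - 12*q^4*r - 36*q^4*r^2 + 
      108*q^4*r^3 + 108*q^4*r^4 - 36*q^4*r^5 - 12*q^4*r^6 - 12*q^5*r^2 + 24*q^5*r^3 - 36*q^5*r^4 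
      + 24*q^5*r^5 - 12*q^5*r^6 + 8*q^6*r^3 - 12*q^6*r^4 - 12*q^6*r^5 + 8*q^6*r^6 

def eP3 {S : Type*} [CommRing S] (q r : S) : S :=
  - 12*q*r + 48*q*r^2 - 12*q*r^3 + 18*q^2*r - 36*q^2*r^2 - 36*q^2*r^3 + 18*q^2*r^4 + 
      18*q^3*r - 96*q^3*r^2 + 108*q^3*r^3 - 96*q^3*r^4 + 18*q^3*r^5 - 12*q^4*r - 36*q^4*r^2 + 
      108*q^4*r^3 + 108*q^4*r^4 - 36*q^4*r^5 - 12*q^4*r^6 + 48*q^5*r^2 - 36*q^5*r^3 - 96*q^5*r^4 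
      - 36*q^5*r^5 + 48*q^5*r^6 - 12*q^6*r^3 + 18*q^6*r^4 + 18*q^6*r^5 - 12*q^6*r^6 

def eP4 {S : Type*} [CommRing S] (q r : S) : S :=
  - 12*q^2*r^2 - 12*q^2*r^3 + 18*q^3*r^2 + 24*q^3*r^3 + 18*q^3*r^4 + 18*q^4*r^2 - 36*q^4*r^3 
      - 36*q^4*r^4 + 18*q^4*r^5 - 12*q^5*r^2 + 24*q^5*r^3 - 36*q^5*r^4 + 24*q^5*r^5 - 12*q^5*r^6 
      - 12*q^6*r^3 + 18*q^6*r^4 + 18*q^6*r^5 - 12*q^6*r^6 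

def eP5 {S : Type*} [CommRing S] (q r : S) : S :=
  8*q^3*r^3 - 12*q^4*r^3 - 12*q^4*r^4 - 12*q^5*r^3 + 48*q^5*r^4 - 12*q^5*r^5 + 8*q^6*r^3 - 
      12*q^6*r^4 - 12*q^6*r^5 + 8*q^6*r^6 

set_option maxHeartbeats 4000000 in
theorem eF_lead {S : Type*} [CommRing S] (p q r : S) : ∃ P Q R : S,
    eA ((0-(p*q*r))^2) ((0-(q*r))^2) ((0-r)^2) ((0-1)^2) 1 (((p*q*r)-(q*r))^2) (((p*q*r)-r)^2) 
      (((p*q*r)-1)^2) 1 (((q*r)-r)^2) (((q*r)-1)^2) 1 ((r-1)^2) 1 1  * eB ((0-(p*q*r))^2) ((0-(q*r))^2) ((0-r)^2) ((0-1)^2) 1 (((p*q*r)-(q*r))^2) (((p*q*r)-r)^2) 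
      (((p*q*r)-1)^2) 1 (((q*r)-r)^2) (((q*r)-1)^2) 1 ((r-1)^2) 1 1  - 3 * eC ((0-(p*q*r))^2) ((0-(q*r))^2) ((0-r)^2) ((0-1)^2) 1 (((p*q*r)-(q*r))^2) (((p*q*r)-r)^2) 
      (((p*q*r)-1)^2) 1 (((q*r)-r)^2) (((q*r)-1)^2) 1 ((r-1)^2) 1 1  =
      q ^ 3 * r ^ 6 * (8 + (p * P + q * Q + r * R)) := by
  refine ⟨p^0 * eP0 q r + p^1 * eP1 q r + p^2 * eP2 q r + p^3 * eP3 q r + p^4 * eP4 q r + p^5 * eP5 q r, - 12*r + 48*r^2 - 12*r^3 - 12*q*r^2 - 12*q*r^3 + 8*q^2*r^3 , - 12 - 12*r + 8*r^2 , ?_⟩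
  unfold eA eB eC eP0 eP1 eP2 eP3 eP4 eP5
  ring

theorem map_eA {S T : Type*} [CommRing S] [CommRing T] (f : S →+* T)
    (e12 e13 e14 e15 e16 e23 e24 e25 e26 e34 e35 e36 e45 e46 e56 : S) :
    f (eA e12 e13 e14 e15 e16 e23 e24 e25 e26 e34 e35 e36 e45 e46 e56) =
      eA (f e12) (f e13) (f e14) (f e15) (f e16) (f e23) (f e24) (f e25) (f e26) (f e34) (f e35) (f 
      e36) (f e45) (f e46) (f e56)  := by
  simp only [eA, map_add, map_mul]

theorem map_eB {S T : Type*} [CommRing S] [CommRing T] (f : S →+* T)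
    (e12 e13 e14 e15 e16 e23 e24 e25 e26 e34 e35 e36 e45 e46 e56 : S) :
    f (eB e12 e13 e14 e15 e16 e23 e24 e25 e26 e34 e35 e36 e45 e46 e56) =
      eB (f e12) (f e13) (f e14) (f e15) (f e16) (f e23) (f e24) (f e25) (f e26) (f e34) (f e35) (f 
      e36) (f e45) (f e46) (f e56)  := by
  simp only [eB, map_add, map_mul]

theorem map_eC {S T : Type*} [CommRing S] [CommRing T] (f : S →+* T)
    (e12 e13 e14 e15 e16 e23 e24 e25 e26 e34 e35 e36 e45 e46 e56 : S) :
    f (eC e12 e13 e14 e15 e16 e23 e24 e25 e26 e34 e35 e36 e45 e46 e56) =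
      eC (f e12) (f e13) (f e14) (f e15) (f e16) (f e23) (f e24) (f e25) (f e26) (f e34) (f e35) (f 
      e36) (f e45) (f e46) (f e56)  := by
  simp only [eC, map_add, map_mul]


def vO {K : Type*} [Field K] (v : AddValuation K (WithTop ℝ)) : Subring K where
  carrier := {x | 0 ≤ v x}
  mul_mem' := by
    intro a b ha hb
    simp only [Set.mem_ofPred_eq, v.map_mul] at *
    exact add_nonneg ha hb
  one_mem' := by simp [v.map_one]
  add_mem' := by
    intro a b ha hb
    exact v.map_le_add ha hb
  zero_mem' := by simp [v.map_zero]
  neg_mem' := by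
    intro a ha
    simpa only [Set.mem_ofPred_eq, v.map_neg] using ha

theorem small_comb {K : Type*} [Field K] (v : AddValuation K (WithTop ℝ)) (p q r P Q R : K)
    (hp : 0 < v p) (hq : 0 < v q) (hr : 0 < v r) (hP : 0 ≤ v P) (hQ : 0 ≤ v Q) (hR : 0 ≤ v R) :
    0 < v (p * P + q * Q + r * R) := by
  refine v.map_lt_add (v.map_lt_add ?_ ?_) ?_ <;> rw [v.map_mul]
  · exact add_pos_of_pos_of_nonneg hp hP
  · exact add_pos_of_pos_of_nonneg hq hQ
  · exact add_pos_of_pos_of_nonneg hr hR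

theorem lead_val {K : Type*} [Field K] (v : AddValuation K (WithTop ℝ)) (p q r : K)
    (hp : 0 < v p) (hq : 0 < v q) (hr : 0 < v r) :
    ∃ x y : K, 0 < v x ∧ 0 < v y ∧
    eA ((0-(p*q*r))^2) ((0-(q*r))^2) ((0-r)^2) ((0-1)^2) 1 (((p*q*r)-(q*r))^2) (((p*q*r)-r)^2) 
      (((p*q*r)-1)^2) 1 (((q*r)-r)^2) (((q*r)-1)^2) 1 ((r-1)^2) 1 1  = r ^ 2 * (6 + x) ∧
    eA ((0-(p*q*r))^2) ((0-(q*r))^2) ((0-r)^2) ((0-1)^2) 1 (((p*q*r)-(q*r))^2) (((p*q*r)-r)^2) 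
      (((p*q*r)-1)^2) 1 (((q*r)-r)^2) (((q*r)-1)^2) 1 ((r-1)^2) 1 1  * eB ((0-(p*q*r))^2) ((0-(q*r))^2) ((0-r)^2) ((0-1)^2) 1 (((p*q*r)-(q*r))^2) (((p*q*r)-r)^2) 
      (((p*q*r)-1)^2) 1 (((q*r)-r)^2) (((q*r)-1)^2) 1 ((r-1)^2) 1 1  - 3 * eC ((0-(p*q*r))^2) ((0-(q*r))^2) ((0-r)^2) ((0-1)^2) 1 (((p*q*r)-(q*r))^2) (((p*q*r)-r)^2) 
      (((p*q*r)-1)^2) 1 (((q*r)-r)^2) (((q*r)-1)^2) 1 ((r-1)^2) 1 1  =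
      q ^ 3 * r ^ 6 * (8 + y) := by
  obtain ⟨P, Q, R, h⟩ := eA_lead (S := vO v) ⟨p, hp.le⟩ ⟨q, hq.le⟩ ⟨r, hr.le⟩
  obtain ⟨P', Q', R', h'⟩ := eF_lead (S := vO v) ⟨p, hp.le⟩ ⟨q, hq.le⟩ ⟨r, hr.le⟩
  refine ⟨_, _, small_comb v p q r P Q R hp hq hr P.2 Q.2 R.2,
    small_comb v p q r P' Q' R' hp hq hr P'.2 Q'.2 R'.2, ?_, ?_⟩
  · have := congrArg (vO v).subtype h
    simpa only [map_eA, map_sub, map_add, map_mul, map_pow, map_one, map_zero, map_ofNat,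
      Subring.subtype_apply] using this
  · have := congrArg (vO v).subtype h'
    simpa only [map_eA, map_eB, map_eC, map_sub, map_add, map_mul, map_pow, map_one, map_zero,
      map_ofNat, Subring.subtype_apply] using this

/-- `x` and `y` agree up to a factor in `1 + M`. -/
def Rel {K : Type*} [Field K] (v : AddValuation K (WithTop ℝ)) (x y : K) : Prop :=
  ∃ u, 0 < v (u - 1) ∧ x = y * u

section rel
variable {K : Type*} [Field K] {v : AddValuation K (WithTop ℝ)}

theorem unit_val {u : K} (h : 0 < v (u - 1)) : v u = 0 := by
  have := v.map_eq_of_lt_sub (x := 1) (y := u) (by rwa [v.map_one])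
  rwa [v.map_one] at this

theorem Rel.val_eq {x y : K} (h : Rel v x y) : v x = v y := by
  obtain ⟨u, hu, rfl⟩ := h
  rw [v.map_mul, unit_val hu, add_zero]

theorem Rel.mul {x y x' y' : K} (h : Rel v x y) (h' : Rel v x' y') :
    Rel v (x * x') (y * y') := by
  obtain ⟨u, hu, rfl⟩ := h
  obtain ⟨w, hw, rfl⟩ := h'
  refine ⟨u * w, ?_, by ring⟩
  have : u * w - 1 = (u - 1) * w + (w - 1) := by ring
  rw [this]
  refine v.map_lt_add ?_ hw
  rwa [v.map_mul, unit_val hw, add_zero]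

theorem Rel.inv {x y : K} (h : Rel v x y) : Rel v x⁻¹ y⁻¹ := by
  obtain ⟨u, hu, rfl⟩ := h
  have hu0 : u ≠ 0 := by
    rintro rfl
    have := unit_val hu
    rw [v.map_zero] at this
    exact absurd this (by simp)
  refine ⟨u⁻¹, ?_, by rw [mul_inv]⟩
  have h1 : v u⁻¹ = 0 := by
    have := v.map_mul u u⁻¹
    rw [mul_inv_cancel₀ hu0, v.map_one, unit_val hu, zero_add] at this
    exact this.symm
  have : u⁻¹ - 1 = -((u - 1) * u⁻¹) := by field_simp; ring
  rw [this, v.map_neg, v.map_mul, h1, add_zero]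
  exact hu

theorem Rel.div {x y x' y' : K} (h : Rel v x y) (h' : Rel v x' y') :
    Rel v (x / x') (y / y') := by
  simpa only [div_eq_mul_inv] using h.mul h'.inv

theorem Rel.pow {x y : K} (h : Rel v x y) (n : ℕ) : Rel v (x ^ n) (y ^ n) := by
  induction n with
  | zero => exact ⟨1, by simp [v.map_zero], by simp⟩
  | succ n ih => simpa only [pow_succ] using ih.mul h

theorem val_div {a b : K} {s t : ℝ} (ha : v a = (s : WithTop ℝ)) (hb : v b = (t : WithTop ℝ)) :
    v (a / b) = ((s - t : ℝ) : WithTop ℝ) := by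
  have hb0 : b ≠ 0 := by
    rintro rfl
    rw [v.map_zero] at hb
    exact absurd hb (by simp)
  have h := v.map_mul (a / b) b
  rw [div_mul_cancel₀ _ hb0, ha, hb] at h
  obtain hx | hx := eq_or_ne (v (a / b)) ⊤
  · rw [hx] at h
    exact absurd h (by simp)
  · obtain ⟨x, hx⟩ := WithTop.ne_top_iff_exists.1 hx
    rw [← hx] at h
    have h2 : ((s : ℝ) : WithTop ℝ) = ((x + t : ℝ) : WithTop ℝ) := h
    have h3 : s = x + t := WithTop.coe_injective h2
    rw [h3, add_sub_cancel_right, hx]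

theorem val_mul' {a b : K} {s t : ℝ} (ha : v a = (s : WithTop ℝ)) (hb : v b = (t : WithTop ℝ)) :
    v (a * b) = ((s + t : ℝ) : WithTop ℝ) := by
  rw [v.map_mul, ha, hb]; rfl

theorem val_pow' {a : K} {s : ℝ} (ha : v a = (s : WithTop ℝ)) (n : ℕ) :
    v (a ^ n) = ((n * s : ℝ) : WithTop ℝ) := by
  induction n with
  | zero => simp [v.map_one]
  | succ n ih =>
    rw [pow_succ, val_mul' ih ha]
    congr 1
    push_cast; ring

/-- If `v a > v b` then `b - a` agrees with `b`. -/
theorem rel_sub {a b : K} {s t : ℝ} (ha : v a = (s : WithTop ℝ)) (hb : v b = (t : WithTop ℝ))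
    (h : t < s) : Rel v (b - a) b := by
  have hb0 : b ≠ 0 := by
    rintro rfl
    rw [v.map_zero] at hb
    exact absurd hb (by simp)
  refine ⟨1 - a / b, ?_, by field_simp⟩
  have : 1 - a / b - 1 = -(a / b) := by ring
  rw [this, v.map_neg, val_div ha hb]
  exact_mod_cast sub_pos.2 h

theorem val_dlt {a b : K} {s t : ℝ} (ha : v a = (s : WithTop ℝ)) (hb : v b = (t : WithTop ℝ))
    (h : t < s) : v (dlt a b) = ((2 * t : ℝ) : WithTop ℝ) := by
  have h1 := (rel_sub ha hb h).val_eq.trans hb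
  rw [dlt_comm, dlt, val_pow' h1]
  norm_num

theorem val_two_three (h6 : v (6 : K) = 0) : v (2 : K) = 0 := by
  have h2 : 0 ≤ v (2 : K) := natCast_mem (vO v) 2
  have h3 : 0 ≤ v (3 : K) := natCast_mem (vO v) 3
  have h : v (6 : K) = v (2 : K) + v (3 : K) := by rw [← v.map_mul]; norm_num
  rw [h6] at h
  refine le_antisymm ?_ h2
  rw [h]
  exact le_add_of_nonneg_right h3

end rel


theorem rel_ne {K : Type*} [Field K] {v : AddValuation K (WithTop ℝ)} {x y : K} {t : ℝ}
    (h : Rel v x y) (hy : v y = (t : WithTop ℝ)) : x ≠ 0 := by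
  rintro rfl
  have := h.val_eq
  rw [v.map_zero, hy] at this
  exact absurd this (by simp)

theorem main_aux {K : Type*} [Field K] (v : AddValuation K (WithTop ℝ))
    (a₁ a₂ a₃ a₄ a₅ a₆ : K)
    (ω₁ ω₂ ω₃ ω₄ ω₅ ω₆ : ℝ)
    (hω₁ : v a₁ = ((-ω₁ : ℝ) : WithTop ℝ)) (hω₂ : v a₂ = ((-ω₂ : ℝ) : WithTop ℝ))
    (hω₃ : v a₃ = ((-ω₃ : ℝ) : WithTop ℝ)) (hω₄ : v a₄ = ((-ω₄ : ℝ) : WithTop ℝ))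
    (hω₅ : v a₅ = ((-ω₅ : ℝ) : WithTop ℝ)) (hω₆ : v a₆ = ((-ω₆ : ℝ) : WithTop ℝ))
    (h₁₂ : ω₁ < ω₂) (h₂₃ : ω₂ < ω₃) (h₃₄ : ω₃ < ω₄) (h₄₅ : ω₄ < ω₅) (h₅₆ : ω₅ < ω₆)
    (h6 : v (6 : K) = (0 : WithTop ℝ))
    (L₀ L₁ L₂ : ℝ)
    (hL₀ : L₀ = (ω₄ - ω₃) / 2) (hL₁ : L₁ = 2 * (ω₅ - ω₄)) (hL₂ : L₂ = 2 * (ω₃ - ω₂)) :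
    let A := igusaA a₁ a₂ a₃ a₄ a₅ a₆
    let B := igusaB a₁ a₂ a₃ a₄ a₅ a₆
    let C := igusaC a₁ a₂ a₃ a₄ a₅ a₆
    let D := igusaD a₁ a₂ a₃ a₄ a₅ a₆
    v (A * B - 3 * C) = ((-(3 * ω₃ + 3 * ω₄ + 6 * ω₅ + 6 * ω₆) : ℝ) : WithTop ℝ) ∧
    v (A * B - 3 * C - 8 * (a₃ ^ 3 * a₄ ^ 3 * a₅ ^ 6 * a₆ ^ 6)) > v (A * B - 3 * C) ∧
    v (A ^ 2 * (A * B - 3 * C) / D) = ((-(L₁ + 6 * L₀ + L₂) : ℝ) : WithTop ℝ) := by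
  intro A B C D
  obtain ⟨d1, hd1⟩ : ∃ d, d = a₆ - a₁ := ⟨_, rfl⟩
  obtain ⟨d2, hd2⟩ : ∃ d, d = a₆ - a₂ := ⟨_, rfl⟩
  obtain ⟨d3, hd3⟩ : ∃ d, d = a₆ - a₃ := ⟨_, rfl⟩
  obtain ⟨d4, hd4⟩ : ∃ d, d = a₆ - a₄ := ⟨_, rfl⟩
  obtain ⟨d5, hd5⟩ : ∃ d, d = a₆ - a₅ := ⟨_, rfl⟩
  have R1 : Rel v d1 a₆ := hd1 ▸ rel_sub hω₁ hω₆ (by linarith)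
  have R2 : Rel v d2 a₆ := hd2 ▸ rel_sub hω₂ hω₆ (by linarith)
  have R3 : Rel v d3 a₆ := hd3 ▸ rel_sub hω₃ hω₆ (by linarith)
  have R4 : Rel v d4 a₆ := hd4 ▸ rel_sub hω₄ hω₆ (by linarith)
  have R5 : Rel v d5 a₆ := hd5 ▸ rel_sub hω₅ hω₆ (by linarith)
  have S2 : Rel v (a₂ - a₁) a₂ := rel_sub hω₁ hω₂ (by linarith)
  have S3 : Rel v (a₃ - a₁) a₃ := rel_sub hω₁ hω₃ (by linarith)
  have S4 : Rel v (a₄ - a₁) a₄ := rel_sub hω₁ hω₄ (by linarith)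
  have S5 : Rel v (a₅ - a₁) a₅ := rel_sub hω₁ hω₅ (by linarith)
  have n1 : d1 ≠ 0 := rel_ne R1 hω₆
  have n2 : d2 ≠ 0 := rel_ne R2 hω₆
  have n3 : d3 ≠ 0 := rel_ne R3 hω₆
  have n4 : d4 ≠ 0 := rel_ne R4 hω₆
  have n5 : d5 ≠ 0 := rel_ne R5 hω₆
  have m2 : a₂ - a₁ ≠ 0 := rel_ne S2 hω₂
  have m3 : a₃ - a₁ ≠ 0 := rel_ne S3 hω₃
  have m4 : a₄ - a₁ ≠ 0 := rel_ne S4 hω₄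
  have m5 : a₅ - a₁ ≠ 0 := rel_ne S5 hω₅
  have z2 : a₂ ≠ 0 := by
    intro h; rw [h, v.map_zero] at hω₂; exact WithTop.top_ne_coe hω₂
  have z3 : a₃ ≠ 0 := by
    intro h; rw [h, v.map_zero] at hω₃; exact WithTop.top_ne_coe hω₃
  have z4 : a₄ ≠ 0 := by
    intro h; rw [h, v.map_zero] at hω₄; exact WithTop.top_ne_coe hω₄
  have z5 : a₅ ≠ 0 := by
    intro h; rw [h, v.map_zero] at hω₅; exact WithTop.top_ne_coe hω₅
  have z6 : a₆ ≠ 0 := by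
    intro h; rw [h, v.map_zero] at hω₆; exact WithTop.top_ne_coe hω₆
  obtain ⟨b2, hb2⟩ : ∃ b, b = (a₂ - a₁) / d2 := ⟨_, rfl⟩
  have T2 : Rel v b2 (a₂ / a₆) := hb2 ▸ S2.div R2
  have k2 : b2 ≠ 0 := hb2 ▸ div_ne_zero m2 n2
  obtain ⟨b3, hb3⟩ : ∃ b, b = (a₃ - a₁) / d3 := ⟨_, rfl⟩
  have T3 : Rel v b3 (a₃ / a₆) := hb3 ▸ S3.div R3
  have k3 : b3 ≠ 0 := hb3 ▸ div_ne_zero m3 n3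
  obtain ⟨b4, hb4⟩ : ∃ b, b = (a₄ - a₁) / d4 := ⟨_, rfl⟩
  have T4 : Rel v b4 (a₄ / a₆) := hb4 ▸ S4.div R4
  have k4 : b4 ≠ 0 := hb4 ▸ div_ne_zero m4 n4
  obtain ⟨b5, hb5⟩ : ∃ b, b = (a₅ - a₁) / d5 := ⟨_, rfl⟩
  have T5 : Rel v b5 (a₅ / a₆) := hb5 ▸ S5.div R5
  have k5 : b5 ≠ 0 := hb5 ▸ div_ne_zero m5 n5
  obtain ⟨κ, hκ⟩ : ∃ k, k = b5 / d1 := ⟨_, rfl⟩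
  obtain ⟨p, hp⟩ : ∃ k, k = b2 / b3 := ⟨_, rfl⟩
  obtain ⟨q, hq⟩ : ∃ k, k = b3 / b4 := ⟨_, rfl⟩
  obtain ⟨r, hr⟩ : ∃ k, k = b4 / b5 := ⟨_, rfl⟩
  have Rκ : Rel v κ (a₅ / a₆ / a₆) := hκ ▸ T5.div R1
  have Rp : Rel v p (a₂ / a₆ / (a₃ / a₆)) := hp ▸ T2.div T3
  have Rq : Rel v q (a₃ / a₆ / (a₄ / a₆)) := hq ▸ T3.div T4
  have Rr : Rel v r (a₄ / a₆ / (a₅ / a₆)) := hr ▸ T4.div T5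
  have nκ : κ ≠ 0 := hκ ▸ div_ne_zero k5 n1
  have vp : 0 < v p := by
    rw [Rp.val_eq, val_div (val_div hω₂ hω₆) (val_div hω₃ hω₆)]
    exact WithTop.coe_pos.2 (by linarith)
  have vq : 0 < v q := by
    rw [Rq.val_eq, val_div (val_div hω₃ hω₆) (val_div hω₄ hω₆)]
    exact WithTop.coe_pos.2 (by linarith)
  have vr : 0 < v r := by
    rw [Rr.val_eq, val_div (val_div hω₄ hω₆) (val_div hω₅ hω₆)]
    exact WithTop.coe_pos.2 (by linarith)
  obtain ⟨x, y, hx, hy, hA, hF⟩ := lead_val v p q r vp vq vr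
  have hr' : r * b5 = b4 := by rw [hr, div_mul_cancel₀ _ k5]
  have hqr : q * r * b5 = b3 := by rw [mul_assoc, hr', hq, div_mul_cancel₀ _ k4]
  have hpqr : p * q * r * b5 = b2 := by
    rw [mul_assoc p, mul_assoc p, hqr, hp, div_mul_cancel₀ _ k3]
  have hκ' : κ * d1 = b5 := by rw [hκ, div_mul_cancel₀ _ n1]
  have hb2' : b2 * d2 = a₂ - a₁ := by rw [hb2, div_mul_cancel₀ _ n2]
  have hb3' : b3 * d3 = a₃ - a₁ := by rw [hb3, div_mul_cancel₀ _ n3]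
  have hb4' : b4 * d4 = a₄ - a₁ := by rw [hb4, div_mul_cancel₀ _ n4]
  have hb5' : b5 * d5 = a₅ - a₁ := by rw [hb5, div_mul_cancel₀ _ n5]
  have gen : ∀ x y s t c d : K, s * b5 * c = x - a₁ → t * b5 * d = y - a₁ →
      c = a₆ - x → d = a₆ - y → dlt x y = (s - t) ^ 2 * ((c ^ 2 * κ) * (d ^ 2 * κ)) := by
    intro x y s t c d h1 h2 hc hd
    have h3 : x - y = (s - t) * c * d * κ := by
      apply mul_right_cancel₀ n1
      linear_combination (-d) * h1 + c * h2 - (s - t) * c * d * hκ' + (x - y) * hd1 +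
        (a₁ - x) * hd - (a₁ - y) * hc
    rw [dlt, h3]; ring
  have g1 : 0 * b5 * d1 = a₁ - a₁ := by ring
  have g2 : p * q * r * b5 * d2 = a₂ - a₁ := by rw [hpqr, hb2']
  have g3 : q * r * b5 * d3 = a₃ - a₁ := by rw [hqr, hb3']
  have g4 : r * b5 * d4 = a₄ - a₁ := by rw [hr', hb4']
  have g5 : 1 * b5 * d5 = a₅ - a₁ := by rw [one_mul, hb5']
  have gen6 : ∀ x c : K, c = a₆ - x → dlt x a₆ = 1 * ((c ^ 2 * κ) * κ⁻¹) := by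
    intro x c hc
    rw [mul_assoc (c ^ 2), mul_inv_cancel₀ nκ, hc, dlt]; ring
  obtain ⟨sA, sB, sC⟩ := scale a₁ a₂ a₃ a₄ a₅ a₆ (d1 ^ 2 * κ) (d2 ^ 2 * κ) (d3 ^ 2 * κ)
    (d4 ^ 2 * κ) (d5 ^ 2 * κ) κ⁻¹ _ _ _ _ _ _ _ _ _ _ _ _ _ _ _  
    (gen _ _ _ _ _ _ g1 g2 hd1 hd2)
    (gen _ _ _ _ _ _ g1 g3 hd1 hd3)
    (gen _ _ _ _ _ _ g1 g4 hd1 hd4)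
    (gen _ _ _ _ _ _ g1 g5 hd1 hd5)
    (gen6 _ _ hd1)
    (gen _ _ _ _ _ _ g2 g3 hd2 hd3)
    (gen _ _ _ _ _ _ g2 g4 hd2 hd4)
    (gen _ _ _ _ _ _ g2 g5 hd2 hd5)
    (gen6 _ _ hd2)
    (gen _ _ _ _ _ _ g3 g4 hd3 hd4)
    (gen _ _ _ _ _ _ g3 g5 hd3 hd5)
    (gen6 _ _ hd3)
    (gen _ _ _ _ _ _ g4 g5 hd4 hd5)
    (gen6 _ _ hd4)
    (gen6 _ _ hd5)
  have hc : d1 ^ 2 * κ * (d2 ^ 2 * κ) * (d3 ^ 2 * κ) * (d4 ^ 2 * κ) * (d5 ^ 2 * κ) * κ⁻¹ =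
      (d1 * d2 * d3 * d4 * d5) ^ 2 * κ ^ 4 := by field_simp
  rw [hc] at sA sB sC
  have Rc := (((((R1.mul R2).mul R3).mul R4).mul R5).pow 2).mul (Rκ.pow 4)
  have eFF : A * B - 3 * C =
      ((d1 * d2 * d3 * d4 * d5) ^ 2 * κ ^ 4) ^ 3 * (q ^ 3 * r ^ 6) * (8 + y) := by
    rw [mul_assoc _ (q ^ 3 * r ^ 6), ← hF]
    simp only [A, B, C, sA, sB, sC]
    ring
  have eAA : A = ((d1 * d2 * d3 * d4 * d5) ^ 2 * κ ^ 4) * r ^ 2 * (6 + x) := by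
    rw [mul_assoc _ (r ^ 2), ← hA]
    exact sA
  have RF := (Rc.pow 3).mul ((Rq.pow 3).mul (Rr.pow 6))
  have RA := Rc.mul (Rr.pow 2)
  have mF : ((a₆ * a₆ * a₆ * a₆ * a₆) ^ 2 * (a₅ / a₆ / a₆) ^ 4) ^ 3 *
      ((a₃ / a₆ / (a₄ / a₆)) ^ 3 * (a₄ / a₆ / (a₅ / a₆)) ^ 6) =
      a₃ ^ 3 * a₄ ^ 3 * a₅ ^ 6 * a₆ ^ 6 := by field_simp
  have mA : ((a₆ * a₆ * a₆ * a₆ * a₆) ^ 2 * (a₅ / a₆ / a₆) ^ 4) *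
      (a₄ / a₆ / (a₅ / a₆)) ^ 2 = a₄ ^ 2 * a₅ ^ 2 * a₆ ^ 2 := by field_simp
  rw [mF] at RF
  rw [mA] at RA
  have v2 := val_two_three h6
  have v8 : v (8 : K) = 0 := by
    have : (8 : K) = 2 * 2 * 2 := by norm_num
    rw [this, v.map_mul, v.map_mul, v2]; simp
  have v8y : v (8 + y) = 0 := by
    rw [v.map_add_eq_of_lt_left (by rwa [v8]), v8]
  have v6x : v (6 + x) = ((0 : ℝ) : WithTop ℝ) := by
    rw [v.map_add_eq_of_lt_left (by rwa [h6]), h6]; rfl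
  have vm := val_mul' (val_mul' (val_mul' (val_pow' hω₃ 3) (val_pow' hω₄ 3)) (val_pow' hω₅ 6))
    (val_pow' hω₆ 6)
  have vF : v (A * B - 3 * C) =
      ((-(3 * ω₃ + 3 * ω₄ + 6 * ω₅ + 6 * ω₆) : ℝ) : WithTop ℝ) := by
    rw [eFF, v.map_mul, v8y, add_zero, RF.val_eq, vm]
    congr 1
    push_cast; ring
  have vA : v A = ((-(2 * ω₄ + 2 * ω₅ + 2 * ω₆) : ℝ) : WithTop ℝ) := by
    rw [eAA, val_mul' (RA.val_eq.trans (val_mul' (val_mul' (val_pow' hω₄ 2) (val_pow' hω₅ 2))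
      (val_pow' hω₆ 2))) v6x]
    congr 1
    push_cast; ring
  refine ⟨vF, ?_, ?_⟩
  · obtain ⟨u, hu, hu'⟩ := RF
    have e1 : A * B - 3 * C - 8 * (a₃ ^ 3 * a₄ ^ 3 * a₅ ^ 6 * a₆ ^ 6) =
        (a₃ ^ 3 * a₄ ^ 3 * a₅ ^ 6 * a₆ ^ 6) * ((u - 1) * (8 + y) + y) := by
      rw [eFF, hu']; ring
    have e2 : 0 < v ((u - 1) * (8 + y) + y) := by
      refine v.map_lt_add ?_ hy
      rwa [v.map_mul, v8y, add_zero]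
    have e3 : v (A * B - 3 * C) = v (a₃ ^ 3 * a₄ ^ 3 * a₅ ^ 6 * a₆ ^ 6) := by
      rw [eFF, hu', v.map_mul, v.map_mul, v8y, unit_val hu, add_zero, add_zero]
    rw [e1, e3, v.map_mul, vm, gt_iff_lt]
    generalize v ((u - 1) * (8 + y) + y) = w at e2
    induction w using WithTop.recTopCoe with
    | top => rw [WithTop.add_top]; exact WithTop.coe_lt_top _
    | coe w =>
      have := WithTop.coe_pos.1 e2
      rw [← WithTop.coe_add, WithTop.coe_lt_coe]
      linarith
  · have vD : v D = _ := (val_mul' (val_mul' (val_mul' (val_mul' (val_mul' (val_mul' (val_mul' (val_mul' (val_mul' (val_mul' (val_mul' (val_mul' (val_mul' (val_mul' (val_dlt hω₁ hω₂ (neg_lt_neg (by linarith)))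
      (val_dlt hω₁ hω₃ (neg_lt_neg (by linarith))))
      (val_dlt hω₁ hω₄ (neg_lt_neg (by linarith))))
      (val_dlt hω₁ hω₅ (neg_lt_neg (by linarith))))
      (val_dlt hω₁ hω₆ (neg_lt_neg (by linarith))))
      (val_dlt hω₂ hω₃ (neg_lt_neg (by linarith))))
      (val_dlt hω₂ hω₄ (neg_lt_neg (by linarith))))
      (val_dlt hω₂ hω₅ (neg_lt_neg (by linarith))))
      (val_dlt hω₂ hω₆ (neg_lt_neg (by linarith))))
      (val_dlt hω₃ hω₄ (neg_lt_neg (by linarith))))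
      (val_dlt hω₃ hω₅ (neg_lt_neg (by linarith))))
      (val_dlt hω₃ hω₆ (neg_lt_neg (by linarith))))
      (val_dlt hω₄ hω₅ (neg_lt_neg (by linarith))))
      (val_dlt hω₄ hω₆ (neg_lt_neg (by linarith))))
      (val_dlt hω₅ hω₆ (neg_lt_neg (by linarith))))
    rw [val_div (val_mul' (val_pow' vA 2) vF) vD]
    congr 1
    rw [hL₀, hL₁, hL₂]
    push_cast; ring

end helpers

/-- **The invariant `j₃′ = j₂ − 3j₃` on the dumbbell cone.**
With `ω₁ < ω₂ < ω₃ < ω₄ < ω₅ < ω₆` and `val 6 = 0`, one has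
`val (AB − 3C) = −(3ω₃ + 3ω₄ + 6ω₅ + 6ω₆)` with initial term `8α₃³α₄³α₅⁶α₆⁶`, and
consequently `−val (A²(AB − 3C)/D) = L₁ + 6L₀ + L₂`. -/
theorem j3prime_dumbbell
    {K : Type*} [Field K] (val : K → WithTop ℝ)
    (hval0 : ∀ x : K, val x = ⊤ ↔ x = 0)
    (hvalmul : ∀ x y : K, val (x * y) = val x + val y)
    (hvaladd : ∀ x y : K, min (val x) (val y) ≤ val (x + y))
    (a₁ a₂ a₃ a₄ a₅ a₆ : K)
    (hdist : List.Pairwise (· ≠ ·) [a₁, a₂, a₃, a₄, a₅, a₆])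
    (hne : ∀ a ∈ [a₁, a₂, a₃, a₄, a₅, a₆], a ≠ 0)
    (ω₁ ω₂ ω₃ ω₄ ω₅ ω₆ : ℝ)
    (hω₁ : val a₁ = ((-ω₁ : ℝ) : WithTop ℝ)) (hω₂ : val a₂ = ((-ω₂ : ℝ) : WithTop ℝ))
    (hω₃ : val a₃ = ((-ω₃ : ℝ) : WithTop ℝ)) (hω₄ : val a₄ = ((-ω₄ : ℝ) : WithTop ℝ))
    (hω₅ : val a₅ = ((-ω₅ : ℝ) : WithTop ℝ)) (hω₆ : val a₆ = ((-ω₆ : ℝ) : WithTop ℝ))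
    (h₁₂ : ω₁ < ω₂) (h₂₃ : ω₂ < ω₃) (h₃₄ : ω₃ < ω₄) (h₄₅ : ω₄ < ω₅) (h₅₆ : ω₅ < ω₆)
    (h6 : val (6 : K) = (0 : WithTop ℝ))
    (L₀ L₁ L₂ : ℝ)
    (hL₀ : L₀ = (ω₄ - ω₃) / 2) (hL₁ : L₁ = 2 * (ω₅ - ω₄)) (hL₂ : L₂ = 2 * (ω₃ - ω₂)) :
    let A := igusaA a₁ a₂ a₃ a₄ a₅ a₆
    let B := igusaB a₁ a₂ a₃ a₄ a₅ a₆
    let C := igusaC a₁ a₂ a₃ a₄ a₅ a₆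
    let D := igusaD a₁ a₂ a₃ a₄ a₅ a₆
    val (A * B - 3 * C) = ((-(3 * ω₃ + 3 * ω₄ + 6 * ω₅ + 6 * ω₆) : ℝ) : WithTop ℝ) ∧
    val (A * B - 3 * C - 8 * (a₃ ^ 3 * a₄ ^ 3 * a₅ ^ 6 * a₆ ^ 6)) > val (A * B - 3 * C) ∧
    val (A ^ 2 * (A * B - 3 * C) / D) = ((-(L₁ + 6 * L₀ + L₂) : ℝ) : WithTop ℝ) := by
  intro A B C D
  have hv1 : val 1 = 0 := by
    have h := hvalmul 1 1
    rw [mul_one] at h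
    obtain ⟨x, hx⟩ := WithTop.ne_top_iff_exists.1 (fun h => one_ne_zero ((hval0 (1 : K)).1 h))
    rw [← hx] at h ⊢
    have h2 : ((x : ℝ) : WithTop ℝ) = ((x + x : ℝ) : WithTop ℝ) := h
    have h3 : x = x + x := WithTop.coe_injective h2
    have h4 : x = 0 := by linarith
    rw [h4]; rfl
  let v : AddValuation K (WithTop ℝ) :=
    AddValuation.of val ((hval0 0).2 rfl) hv1 hvaladd hvalmul
  have hv : ∀ x, val x = v x := fun x => rfl
  simp only [hv] at *
  exact main_aux v a₁ a₂ a₃ a₄ a₅ a₆ ω₁ ω₂ ω₃ ω₄ ω₅ ω₆ hω₁ hω₂ hω₃ hω₄ hω₅ hω₆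
    h₁₂ h₂₃ h₃₄ h₄₅ h₅₆ h6 L₀ L₁ L₂ hL₀ hL₁ hL₂

end Genus2Igusa
end
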